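/- arXiv:1504.03755 — 3 statements merged into one kernel-verified Lean document; each statement's English description precedes it below -/
import Mathlib

section
/- Let K be an algebraically closed field and let S ⊆ K^m × K^n be a constructible set with respect to the Zariski topology on K^{m+n}. Then for every d ∈ ℕ, the set { a ∈ K^m : S_a is nonempty and the Krull dimension of the Zariski closure of S_a in K^n equals d } is a constructible subset of K^m, where the Krull dimension of a topological space is the supremum of the lengths r of chains C₀ ⊊ C₁ ⊊ ⋯ ⊊ C_r of irreducible closed subsets. (This is part of Theorem A.6(3) of the paper's appendix: dimension is definable in families.) -/
/-- The Zariski topology on affine space `σ → K`: the closed sets are the common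
zero loci of sets of polynomials over `K`. -/
def zariskiTopology (K : Type*) [CommRing K] (σ : Type*) :
    TopologicalSpace (σ → K) :=
  TopologicalSpace.generateFrom
    {U | ∃ f : MvPolynomial σ K, U = {x | MvPolynomial.eval x f ≠ 0}}

/-- A set is constructible w.r.t. a topology `t` if it is a finite union of
differences of `t`-closed sets (equivalently, a finite Boolean combination of
closed sets). -/
def IsConstructibleIn {α : Type*} (t : TopologicalSpace α) (S : Set α) : Prop :=
  ∃ (r : ℕ) (C D : Fin r → Set α),
    (∀ i, @IsClosed _ t (C i)) ∧ (∀ i, @IsClosed _ t (D i)) ∧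
    S = ⋃ i, C i \ D i

/-- The Krull dimension of a subset `S` of a topological space, i.e. the Krull
dimension of `S` with the subspace topology: the supremum of the lengths of
chains of irreducible closed subsets. -/
noncomputable def krullDimOf {α : Type*} (t : TopologicalSpace α) (S : Set α) :
    WithBot ℕ∞ :=
  @topologicalKrullDim (↥S) (TopologicalSpace.induced Subtype.val t)

section KrullDimension

open MvPolynomial Cardinal

theorem Algebra.trdeg_lt_of_surjective_of_not_injective {k A B : Type*} [Field k] [CommRing A]
    [IsDomain A] [CommRing B] [IsDomain B] [Algebra k A] [Algebra k B] [Algebra.FiniteType k A]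
    {f : A →ₐ[k] B} (hf : Function.Surjective f) (hf' : ¬ Function.Injective f) :
    (Algebra.trdeg k B).toNat < (Algebra.trdeg k A).toNat := by
  have hA : Algebra.trdeg k A < ℵ₀ := trdeg_lt_aleph0_of_finiteType
  have hB : Algebra.trdeg k B < ℵ₀ :=
    have := Algebra.FiniteType.of_surjective f hf
    trdeg_lt_aleph0_of_finiteType
  by_contra! hle
  obtain ⟨s, hs⟩ := exists_isTranscendenceBasis k B
  have hx : AlgebraicIndependent k (fun b : s ↦ Function.surjInv hf b) := by
    refine .of_comp f ?_
    convert! hs.1 using 1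
    exact funext fun b ↦ Function.surjInv_eq hf b.1
  have hsB : (#s).toNat = (Algebra.trdeg k B).toNat := by rw [hs.cardinalMk_eq_trdeg]
  have hsfin : #s < ℵ₀ := hs.cardinalMk_eq_trdeg ▸ hB
  have hbasis : IsTranscendenceBasis k (fun b : s ↦ Function.surjInv hf b) := by
    refine hx.isTranscendenceBasis_of_lift_trdeg_le hA ?_
    rw [← Cardinal.toNat_le_iff_le_of_lt_aleph0 (by simpa) (by rwa [lift_lt_aleph0]),
      Cardinal.toNat_lift, Cardinal.toNat_lift, hsB]
    exact hle
  have := hbasis.isAlgebraic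
  rw [injective_iff_map_eq_zero] at hf'
  push Not at hf'
  obtain ⟨a, ha, ha0⟩ := hf'
  obtain ⟨⟨r, hr⟩, hr0, c, hc⟩ := (Algebra.IsAlgebraic.isAlgebraic
    (R := Algebra.adjoin k (Set.range fun b : s ↦ Function.surjInv hf b))
    a).exists_nonzero_dvd (mem_nonZeroDivisors_of_ne_zero ha0)
  change r = a * c at hc
  rw [Algebra.adjoin_range_eq_range_aeval] at hr
  obtain ⟨q, rfl⟩ := hr
  have hq : aeval (Subtype.val : s → B) q = 0 := by
    have h0 : f (aeval (fun b : s ↦ Function.surjInv hf b) q) = 0 := by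
      refine (congrArg f hc).trans ?_
      rw [map_mul, ha, zero_mul]
    rw [← h0, ← AlgHom.comp_apply, comp_aeval]
    simp only [Function.surjInv_eq hf]
  have hq0 := (injective_iff_map_eq_zero _).1 hs.1 q hq
  exact hr0 (Subtype.ext ((congrArg _ hq0).trans (map_zero _)))

theorem ringKrullDim_le_of_isIntegral_of_injective {A B : Type*} [CommRing A] [CommRing B]
    [IsDomain B] [Algebra A B] [Algebra.IsIntegral A B]
    (h : Function.Injective (algebraMap A B)) : ringKrullDim A ≤ ringKrullDim B := by
  refine iSup_le fun l ↦ ?_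
  obtain ⟨Q, hQ, hQl⟩ := Ideal.exists_ideal_over_prime_of_isIntegral_of_isDomain (S := B)
    (RelSeries.head l).asIdeal (by simp [(RingHom.injective_iff_ker_eq_bot _).1 h])
  have : Q.LiesOver (RelSeries.head l).asIdeal := ⟨hQl.symm⟩
  have : Algebra.HasGoingUp A B := .of_isIntegral
  obtain ⟨L, hL, -⟩ := Ideal.exists_ltSeries_of_hasGoingUp l Q
  rw [← hL]
  exact Order.LTSeries.length_le_krullDim L

variable {K σ : Type*} [Field K] [Finite σ]

theorem exists_embedding_of_le_trdeg {A : Type*} [CommRing A] [IsDomain A] [Algebra K A]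
    {f : MvPolynomial σ K →ₐ[K] A} (hf : Function.Surjective f) {d : ℕ}
    (hd : d ≤ (Algebra.trdeg K A).toNat) :
    ∃ i : Fin d ↪ σ, Function.Injective (f.comp (rename i)) := by
  have hadj : Algebra.adjoin K (Set.range fun j ↦ f (X j)) = ⊤ := by
    rw [Algebra.adjoin_range_eq_range_aeval, ← (AlgHom.range_eq_top f).2 hf]
    exact congrArg AlgHom.range (aeval_unique f).symm
  have : Algebra.IsAlgebraic (Algebra.adjoin K (Set.range fun j ↦ f (X j))) A :=
    ⟨fun a ↦ isAlgebraic_algebraMap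
      (⟨a, hadj ▸ Algebra.mem_top⟩ : Algebra.adjoin K (Set.range fun j ↦ f (X j)))⟩
  obtain ⟨t, hts, ht⟩ := exists_isTranscendenceBasis_subset (R := K) (Set.range fun j ↦ f (X j))
  have : Finite t := (Set.finite_range _).subset hts
  have := Fintype.ofFinite t
  rw [← ht.cardinalMk_eq_trdeg] at hd
  obtain ⟨e⟩ : Nonempty (Fin d ↪ t) := Function.Embedding.nonempty_of_card_le (by simpa using hd)
  choose i hi using fun b : t ↦ hts b.2
  have hi_inj : Function.Injective i := fun a b hab ↦ by rw [Subtype.ext_iff, ← hi a, ← hi b, hab]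
  refine ⟨e.trans ⟨i, hi_inj⟩, ?_⟩
  have hcomp : f.comp (rename (e.trans ⟨i, hi_inj⟩)) = aeval (Subtype.val ∘ e) := by
    ext j
    simp [hi]
  rw [hcomp]
  exact ht.1.comp e e.injective

theorem exists_embedding_of_le_ringKrullDim_quotient {J : Ideal (MvPolynomial σ K)} {d : ℕ}
    (hd : (d : WithBot ℕ∞) ≤ ringKrullDim (MvPolynomial σ K ⧸ J)) :
    ∃ i : Fin d ↪ σ, ∀ q : MvPolynomial (Fin d) K, rename i q ∈ J → q = 0 := by
  rw [ringKrullDim_quotient, ← Order.krullDim_orderDual, Order.le_krullDim_iff] at hd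
  obtain ⟨l, rfl⟩ := hd
  have hmono : StrictMono fun p : (PrimeSpectrum.zeroLocus (J : Set (MvPolynomial σ K)))ᵒᵈ ↦
      (Algebra.trdeg K (MvPolynomial σ K ⧸ p.ofDual.1.asIdeal)).toNat := by
    intro p q hpq
    obtain ⟨hle, hne⟩ := SetLike.lt_iff_le_and_exists.1
      (show q.ofDual.1.asIdeal < p.ofDual.1.asIdeal from hpq)
    obtain ⟨r, hr, hr'⟩ := hne
    refine Algebra.trdeg_lt_of_surjective_of_not_injective
      (f := Ideal.Quotient.factorₐ K hle) (Ideal.Quotient.factor_surjective hle) fun hinj ↦ hr' ?_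
    rw [← Ideal.Quotient.eq_zero_iff_mem]
    exact hinj ((Ideal.Quotient.eq_zero_iff_mem.2 hr).trans (map_zero _).symm)
  have hlen := (l.map _ hmono).head_add_length_le_nat
  replace hlen := (Nat.le_add_left _ _).trans hlen
  obtain ⟨P, hP⟩ : ∃ P : (PrimeSpectrum.zeroLocus (J : Set (MvPolynomial σ K)))ᵒᵈ,
    P = RelSeries.last l := ⟨_, rfl⟩
  change l.length ≤ (Algebra.trdeg K
    (MvPolynomial σ K ⧸ (RelSeries.last l).ofDual.1.asIdeal)).toNat at hlen
  rw [← hP] at hlen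
  obtain ⟨i, hi⟩ := exists_embedding_of_le_trdeg
    (Ideal.Quotient.mkₐ_surjective K P.ofDual.1.asIdeal) hlen
  refine ⟨i, fun q hq ↦ (injective_iff_map_eq_zero _).1 hi q ?_⟩
  exact Ideal.Quotient.eq_zero_iff_mem.2 (P.ofDual.2 hq)

theorem le_ringKrullDim_quotient_of_embedding {J : Ideal (MvPolynomial σ K)} {d : ℕ}
    {i : Fin d ↪ σ} (hi : ∀ q : MvPolynomial (Fin d) K, rename i q ∈ J → q = 0) :
    (d : WithBot ℕ∞) ≤ ringKrullDim (MvPolynomial σ K ⧸ J) := by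
  obtain ⟨P, hP, hJP, hdisj⟩ := Ideal.exists_le_prime_disjoint J
    ((nonZeroDivisors (MvPolynomial (Fin d) K)).map (rename i : _ →ₐ[K] MvPolynomial σ K)) <| by
    rw [Set.disjoint_left]
    rintro _ hJ ⟨q, hq, rfl⟩
    exact nonZeroDivisors.ne_zero hq (hi q hJ)
  refine le_trans ?_ (ringKrullDim_le_of_surjective (Ideal.Quotient.factor hJP)
    (Ideal.Quotient.factor_surjective hJP))
  have hinj : Function.Injective ((Ideal.Quotient.mkₐ K P).comp (rename i)) := by
    rw [injective_iff_map_eq_zero]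
    intro q hq
    by_contra hq0
    exact Set.disjoint_left.1 hdisj (Ideal.Quotient.eq_zero_iff_mem.1 hq)
      ⟨q, mem_nonZeroDivisors_of_ne_zero hq0, rfl⟩
  obtain ⟨s, g, hg, hgi⟩ := exists_integral_inj_algHom_of_fg K (MvPolynomial σ K ⧸ P)
  algebraize [g.toRingHom]
  have : IsScalarTower K (MvPolynomial (Fin s) K) (MvPolynomial σ K ⧸ P) :=
    .of_algebraMap_eq' g.comp_algebraMap.symm
  have : Algebra.IsIntegral (MvPolynomial (Fin s) K) (MvPolynomial σ K ⧸ P) := ⟨hgi⟩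
  have : FaithfulSMul (MvPolynomial (Fin s) K) (MvPolynomial σ K ⧸ P) :=
    (faithfulSMul_iff_algebraMap_injective _ _).2 hg
  refine le_trans ?_ (ringKrullDim_le_of_isIntegral_of_injective
    (A := MvPolynomial (Fin s) K) hg)
  rw [MvPolynomial.ringKrullDim_of_isNoetherianRing, ringKrullDim_eq_zero_of_field, zero_add,
    Nat.card_fin]
  have h1 := (IsTranscendenceBasis.mvPolynomial (Fin s) K).algebraMap_comp
    (A := MvPolynomial σ K ⧸ P) |>.lift_cardinalMk_eq_trdeg
  have h2 : AlgebraicIndependent K fun j ↦ Ideal.Quotient.mkₐ K P (X (i j)) := by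
    have hcomp : (Ideal.Quotient.mkₐ K P).comp (rename i) =
        aeval fun j ↦ Ideal.Quotient.mkₐ K P (X (i j)) := by
      ext j
      simp
    rwa [hcomp] at hinj
  replace h2 := h2.lift_cardinalMk_le_trdeg
  simp only [mk_fin, lift_natCast, lift_id'.{0}] at h1 h2
  rw [← h1] at h2
  exact_mod_cast h2

end KrullDimension

section ZariskiSpectrum

open MvPolynomial Topology

attribute [local instance] zariskiTopology

variable {K : Type*} [Field K] {σ τ : Type*}

theorem mem_asIdeal_pointToPoint {x : σ → K} {p : MvPolynomial σ K} :
    p ∈ (pointToPoint x : PrimeSpectrum (MvPolynomial σ K)).asIdeal ↔ eval x p = 0 :=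
  mem_vanishingIdeal_singleton_iff x p

theorem pointToPoint_isInducing :
    IsInducing (pointToPoint : (σ → K) → PrimeSpectrum (MvPolynomial σ K)) := by
  refine ⟨?_⟩
  rw [PrimeSpectrum.isTopologicalBasis_basic_opens.eq_generateFrom, induced_generateFrom_eq]
  refine congrArg TopologicalSpace.generateFrom (Set.ext fun U ↦ ?_)
  simp only [Set.mem_ofPred_eq, Set.mem_image, Set.mem_range, exists_exists_eq_and]
  refine exists_congr fun f ↦ ?_
  rw [eq_comm]
  refine Eq.congr_left (Set.ext fun x ↦ ?_)
  exact (mem_asIdeal_pointToPoint (x := x) (p := f)).not.symm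

theorem pointToPoint_injective :
    Function.Injective (pointToPoint : (σ → K) → PrimeSpectrum (MvPolynomial σ K)) := by
  intro x y h
  funext i
  have hx : (X i - C (x i) : MvPolynomial σ K) ∈ (pointToPoint x).asIdeal := by
    simp [mem_asIdeal_pointToPoint]
  rw [h, mem_asIdeal_pointToPoint] at hx
  simpa [sub_eq_zero, eq_comm] using hx

theorem comap_rename_pointToPoint (f : τ → σ) (x : σ → K) :
    PrimeSpectrum.comap (rename (R := K) f).toRingHom (pointToPoint x) = pointToPoint (x ∘ f) := by
  ext p
  change rename f p ∈ (pointToPoint x).asIdeal ↔ _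
  rw [mem_asIdeal_pointToPoint, mem_asIdeal_pointToPoint, eval_rename]

theorem isClosed_eval_eq_zero (p : MvPolynomial σ K) :
    IsClosed {x : σ → K | eval x p = 0} := by
  rw [← isOpen_compl_iff]
  exact .basic _ ⟨p, rfl⟩

theorem isClosed_mvPolynomial_zeroLocus (J : Ideal (MvPolynomial σ K)) :
    IsClosed (zeroLocus K J) := by
  have : zeroLocus K J = ⋂ p ∈ J, {x : σ → K | eval x p = 0} := by ext; simp [aeval_eq_eval]
  rw [this]
  exact isClosed_biInter fun p _ ↦ isClosed_eval_eq_zero p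

theorem closure_eq_zeroLocus_vanishingIdeal (S : Set (σ → K)) :
    closure S = zeroLocus K (vanishingIdeal K S) := by
  refine (closure_minimal (zeroLocus_vanishingIdeal_le S)
    (isClosed_mvPolynomial_zeroLocus _)).antisymm ?_
  rw [pointToPoint_isInducing.closure_eq_preimage_closure_image,
    ← PrimeSpectrum.zeroLocus_vanishingIdeal_eq_closure, vanishingIdeal_pointToPoint]
  exact fun x hx ↦ pointToPoint_zeroLocus_le _ ⟨x, hx, rfl⟩

theorem IsClosed.isConstructible_of_noetherianSpace {X : Type*} [TopologicalSpace X]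
    [TopologicalSpace.NoetherianSpace X] {Z : Set X} (hZ : IsClosed Z) : IsConstructible Z :=
  isConstructible_compl.1 <| IsRetrocompact.isConstructible hZ.isOpen_compl
    fun _ _ _ ↦ TopologicalSpace.NoetherianSpace.isCompact _

theorem IsConstructibleIn.exists_preimage_pointToPoint [Finite σ] {T : Set (σ → K)}
    (hT : IsConstructibleIn (zariskiTopology K σ) T) :
    ∃ W : Set (PrimeSpectrum (MvPolynomial σ K)), IsConstructible W ∧ pointToPoint ⁻¹' W = T := by
  obtain ⟨r, C, D, hC, hD, rfl⟩ := hT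
  have key : ∀ Z : Set (σ → K), IsClosed Z →
      ∃ W : Set (PrimeSpectrum (MvPolynomial σ K)), IsConstructible W ∧ pointToPoint ⁻¹' W = Z := by
    intro Z hZ
    obtain ⟨W, hW, rfl⟩ := pointToPoint_isInducing.isClosed_iff.1 hZ
    exact ⟨W, hW.isConstructible_of_noetherianSpace, rfl⟩
  choose W hW hW' using fun i ↦ key _ (hC i)
  choose V hV hV' using fun i ↦ key _ (hD i)
  refine ⟨⋃ i, W i \ V i, .iUnion fun i ↦ (hW i).sdiff (hV i), ?_⟩
  simp [Set.preimage_iUnion, hW', hV']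

theorem isConstructibleIn_biUnion_finset {α ι : Type*} {t : TopologicalSpace α} (s : Finset ι)
    {C D : ι → Set α} (hC : ∀ i ∈ s, IsClosed[t] (C i)) (hD : ∀ i ∈ s, IsClosed[t] (D i)) :
    IsConstructibleIn t (⋃ i ∈ s, C i \ D i) := by
  refine ⟨s.card, fun j ↦ C (s.equivFin.symm j), fun j ↦ D (s.equivFin.symm j),
    fun j ↦ hC _ (s.equivFin.symm j).2, fun j ↦ hD _ (s.equivFin.symm j).2, ?_⟩
  rw [s.equivFin.symm.surjective.iUnion_comp fun i : s ↦ C i \ D i, Set.iUnion_subtype]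

theorem isConstructibleIn_preimage_pointToPoint {W : Set (PrimeSpectrum (MvPolynomial σ K))}
    (hW : IsConstructible W) :
    IsConstructibleIn (zariskiTopology K σ) (pointToPoint ⁻¹' W) := by
  obtain ⟨S, rfl⟩ := PrimeSpectrum.exists_constructibleSetData_iff.2 hW
  simp only [PrimeSpectrum.ConstructibleSetData.toSet, PrimeSpectrum.BasicConstructibleSetData.toSet,
    Set.preimage_iUnion, Set.preimage_sdiff]
  exact isConstructibleIn_biUnion_finset S
    (fun C _ ↦ (PrimeSpectrum.isClosed_zeroLocus _).preimage pointToPoint_isInducing.continuous)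
    (fun C _ ↦ (PrimeSpectrum.isClosed_zeroLocus _).preimage pointToPoint_isInducing.continuous)

theorem IsConstructibleIn.sdiff_zariski [Finite σ] {S T : Set (σ → K)}
    (hS : IsConstructibleIn (zariskiTopology K σ) S)
    (hT : IsConstructibleIn (zariskiTopology K σ) T) :
    IsConstructibleIn (zariskiTopology K σ) (S \ T) := by
  obtain ⟨W, hW, rfl⟩ := hS.exists_preimage_pointToPoint
  obtain ⟨V, hV, rfl⟩ := hT.exists_preimage_pointToPoint
  exact isConstructibleIn_preimage_pointToPoint (hW.sdiff hV)

theorem IsConstructibleIn.iUnion_zariski [Finite σ] {ι : Type*} [Finite ι] {S : ι → Set (σ → K)}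
    (hS : ∀ i, IsConstructibleIn (zariskiTopology K σ) (S i)) :
    IsConstructibleIn (zariskiTopology K σ) (⋃ i, S i) := by
  choose W hW hW' using fun i ↦ (hS i).exists_preimage_pointToPoint
  simp_rw [← hW', ← Set.preimage_iUnion]
  exact isConstructibleIn_preimage_pointToPoint (.iUnion hW)

/-- Over an algebraically closed field, a nonempty constructible set of primes contains a
rational point. -/
theorem exists_pointToPoint_mem_of_isConstructible [IsAlgClosed K] [Finite σ]
    {W : Set (PrimeSpectrum (MvPolynomial σ K))} (hW : IsConstructible W) (hne : W.Nonempty) :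
    ∃ x : σ → K, pointToPoint x ∈ W := by
  obtain ⟨S, rfl⟩ := PrimeSpectrum.exists_constructibleSetData_iff.2 hW
  obtain ⟨w, hw⟩ := hne
  obtain ⟨C, hC, hwC⟩ := Set.mem_iUnion₂.1 hw
  have hlc : IsLocallyClosed C.toSet :=
    (PrimeSpectrum.isClosed_zeroLocus _).isLocallyClosed.inter
      (PrimeSpectrum.isClosed_zeroLocus _).isOpen_compl.isLocallyClosed
  obtain ⟨v, hvC, hv⟩ := nonempty_inter_closedPoints ⟨w, hwC⟩ hlc
  obtain ⟨x, hx⟩ := isMaximal_iff_eq_vanishingIdeal_singleton.1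
    ((PrimeSpectrum.isClosed_singleton_iff_isMaximal v).1 hv)
  refine ⟨x, Set.mem_iUnion₂.2 ⟨C, hC, ?_⟩⟩
  rwa [← show v = pointToPoint x from PrimeSpectrum.ext hx]

/-- **Chevalley's theorem** for coordinate projections (and diagonals) of affine spaces. -/
theorem IsConstructibleIn.image_comp [IsAlgClosed K] [Finite σ] [Finite τ] (f : τ → σ)
    {T : Set (σ → K)} (hT : IsConstructibleIn (zariskiTopology K σ) T) :
    IsConstructibleIn (zariskiTopology K τ) ((fun x ↦ x ∘ f) '' T) := by
  obtain ⟨W, hW, rfl⟩ := hT.exists_preimage_pointToPoint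
  have hφ : (rename (R := K) f).toRingHom.FinitePresentation := by
    refine AlgHom.FinitePresentation.of_finiteType.1
      (AlgHom.FiniteType.of_comp_finiteType (f := Algebra.ofId K (MvPolynomial τ K)) ?_)
    rw [Subsingleton.elim ((rename (R := K) f).comp _) (Algebra.ofId K (MvPolynomial σ K))]
    exact (RingHom.finiteType_algebraMap (A := K)).2 inferInstance
  convert! isConstructibleIn_preimage_pointToPoint
    (PrimeSpectrum.isConstructible_comap_image hφ hW)
  ext y
  constructor
  · rintro ⟨x, hx, rfl⟩
    exact ⟨_, hx, comap_rename_pointToPoint f x⟩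
  · rintro ⟨w, hw, hwy⟩
    have hy : IsConstructible {(pointToPoint y : PrimeSpectrum (MvPolynomial τ K))} := by
      refine IsClosed.isConstructible_of_noetherianSpace ?_
      exact (PrimeSpectrum.isClosed_singleton_iff_isMaximal _).2
        (isMaximal_iff_eq_vanishingIdeal_singleton.2 ⟨y, rfl⟩)
    have hpre : IsConstructible
        (PrimeSpectrum.comap (rename (R := K) f).toRingHom ⁻¹' {pointToPoint y}) := by
      obtain ⟨S, hS⟩ := PrimeSpectrum.exists_constructibleSetData_iff.2 hy
      rw [← hS, ← PrimeSpectrum.ConstructibleSetData.toSet_map]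
      exact PrimeSpectrum.ConstructibleSetData.isConstructible_toSet _
    obtain ⟨x, hxW, hxy⟩ := exists_pointToPoint_mem_of_isConstructible (hW.inter hpre) ⟨w, hw, hwy⟩
    refine ⟨x, hxW, pointToPoint_injective ?_⟩
    rw [← comap_rename_pointToPoint]
    exact hxy

theorem pointToPoint_mem_zeroLocus {x : σ → K} {J : Ideal (MvPolynomial σ K)} :
    pointToPoint x ∈ PrimeSpectrum.zeroLocus (J : Set (MvPolynomial σ K)) ↔
      x ∈ zeroLocus K J := by
  simp only [PrimeSpectrum.mem_zeroLocus, mem_zeroLocus_iff, Set.subset_def, SetLike.mem_coe,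
    mem_asIdeal_pointToPoint, aeval_eq_eval]

theorem isIrreducible_val_preimage_zeroLocus [IsAlgClosed K] [Finite σ]
    {J P : Ideal (MvPolynomial σ K)} [hP : P.IsPrime] (hJP : J ≤ P) :
    IsIrreducible (Subtype.val ⁻¹' zeroLocus K P : Set (zeroLocus K J)) := by
  have hf : IsInducing fun x : zeroLocus K J ↦
      (pointToPoint x.1 : PrimeSpectrum (MvPolynomial σ K)) :=
    pointToPoint_isInducing.comp .subtypeVal
  have key : ∀ U : Set (PrimeSpectrum (MvPolynomial σ K)), IsOpen U → ⟨P, hP⟩ ∈ U →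
      ∃ x : zeroLocus K J, x.1 ∈ zeroLocus K P ∧ pointToPoint x.1 ∈ U := by
    intro U hU hPU
    obtain ⟨x, hxU, hxP⟩ := exists_pointToPoint_mem_of_isConstructible
      ((isConstructible_compl.1 hU.isClosed_compl.isConstructible_of_noetherianSpace).inter
        (PrimeSpectrum.isClosed_zeroLocus (P : Set _)).isConstructible_of_noetherianSpace)
      ⟨_, hPU, fun _ h ↦ h⟩
    rw [pointToPoint_mem_zeroLocus] at hxP
    exact ⟨⟨x, zeroLocus_anti_mono hJP hxP⟩, hxP, hxU⟩
  have key' : ∀ U : Set (PrimeSpectrum (MvPolynomial σ K)), IsOpen U → ∀ x ∈ zeroLocus K P,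
      pointToPoint x ∈ U → ⟨P, hP⟩ ∈ U := by
    intro U hU x hx hxU
    refine (PrimeSpectrum.le_iff_specializes ⟨P, hP⟩ (pointToPoint x)).1 ?_ |>.mem_open hU hxU
    exact pointToPoint_mem_zeroLocus.2 hx
  constructor
  · obtain ⟨x, hx, -⟩ := key _ isOpen_univ trivial
    exact ⟨x, hx⟩
  · rintro u v hu hv ⟨x, hx, hxu⟩ ⟨y, hy, hyv⟩
    obtain ⟨U, hU, rfl⟩ := hf.isOpen_iff.1 hu
    obtain ⟨V, hV, rfl⟩ := hf.isOpen_iff.1 hv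
    obtain ⟨z, hz, hzUV⟩ := key _ (hU.inter hV) ⟨key' U hU x hx hxu, key' V hV y hy hyv⟩
    exact ⟨z, hz, hzUV⟩

theorem topologicalKrullDim_zeroLocus [IsAlgClosed K] [Finite σ] (J : Ideal (MvPolynomial σ K)) :
    topologicalKrullDim (zeroLocus K J) = ringKrullDim (MvPolynomial σ K ⧸ J) := by
  rw [ringKrullDim_quotient]
  apply le_antisymm
  · have hf : IsInducing (Set.MapsTo.restrict pointToPoint (zeroLocus K J)
        (PrimeSpectrum.zeroLocus (J : Set (MvPolynomial σ K)))
        fun x hx ↦ pointToPoint_mem_zeroLocus.2 hx) :=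
      .of_comp ((pointToPoint_isInducing.continuous.comp continuous_subtype_val).subtype_mk _)
        continuous_subtype_val (pointToPoint_isInducing.comp .subtypeVal)
    refine hf.topologicalKrullDim_le.trans ?_
    rw [Order.krullDim_eq_of_orderIso (PrimeSpectrum.zeroLocusEquivIrreducibleCloseds _),
      Order.krullDim_orderDual]
    rfl
  · rw [← Order.krullDim_orderDual]
    refine Order.krullDim_le_of_strictMono (fun p ↦
      ⟨Subtype.val ⁻¹' zeroLocus K p.ofDual.1.asIdeal,
        isIrreducible_val_preimage_zeroLocus p.ofDual.2,
        (isClosed_mvPolynomial_zeroLocus _).preimage continuous_subtype_val⟩) ?_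
    refine Monotone.strictMono_of_injective ?_ ?_
    · intro p q hpq x hx
      exact zeroLocus_anti_mono (OrderDual.ofDual_le_ofDual.2 hpq) hx
    · intro p q hpq
      have h := congrArg (fun Z : TopologicalSpace.IrreducibleCloseds _ ↦
        Subtype.val '' (Z : Set (zeroLocus K J))) hpq
      simp only [TopologicalSpace.IrreducibleCloseds.coe_mk, Subtype.image_preimage_coe] at h
      rw [Set.inter_eq_right.2 (zeroLocus_anti_mono p.ofDual.2),
        Set.inter_eq_right.2 (zeroLocus_anti_mono q.ofDual.2)] at h
      apply_fun vanishingIdeal K at h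
      simp only [IsPrime.vanishingIdeal_zeroLocus] at h
      exact Subtype.ext (PrimeSpectrum.ext h)

theorem krullDimOf_closure [IsAlgClosed K] [Finite σ] (S : Set (σ → K)) :
    krullDimOf (zariskiTopology K σ) (closure S) =
      ringKrullDim (MvPolynomial σ K ⧸ vanishingIdeal K S) := by
  rw [closure_eq_zeroLocus_vanishingIdeal]
  exact topologicalKrullDim_zeroLocus _

theorem pointToPoint_mem_toSet {x : σ → K}
    {C : PrimeSpectrum.BasicConstructibleSetData (MvPolynomial σ K)} :
    pointToPoint x ∈ C.toSet ↔ (∀ j, eval x (C.g j) = 0) ∧ eval x C.f ≠ 0 := by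
  simp [PrimeSpectrum.BasicConstructibleSetData.toSet, PrimeSpectrum.mem_zeroLocus,
    Set.range_subset_iff, mem_asIdeal_pointToPoint]

/-- The restriction of a polynomial to the fiber over the point `a`. -/
noncomputable def fiberPoly (a : σ → K) :
    MvPolynomial (σ ⊕ τ) K →ₐ[K] MvPolynomial τ K :=
  aeval (Sum.elim (fun i ↦ C (a i)) X)

theorem eval_fiberPoly (a : σ → K) (y : τ → K) (p : MvPolynomial (σ ⊕ τ) K) :
    eval y (fiberPoly a p) = eval (Sum.elim a y) p := by
  rw [fiberPoly, ← aeval_eq_eval, ← aeval_eq_eval, ← AlgHom.comp_apply, comp_aeval]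
  congr 2
  ext (i | i) <;> simp

theorem isClosed_fiberPoly_eq_zero [Infinite K] (p : MvPolynomial (σ ⊕ τ) K) :
    IsClosed {a : σ → K | fiberPoly a p = 0} := by
  have h : {a : σ → K | fiberPoly a p = 0} =
      ⋂ y : τ → K, {a | eval a (aeval (Sum.elim X fun i ↦ C (y i)) p) = 0} := by
    ext a
    rw [Set.mem_iInter, Set.mem_ofPred_eq]
    have (y : τ → K) : eval a (aeval (Sum.elim X fun i ↦ C (y i)) p) = eval y (fiberPoly a p) := by
      rw [eval_fiberPoly, ← aeval_eq_eval, ← aeval_eq_eval, ← AlgHom.comp_apply, comp_aeval]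
      congr 2
      ext (i | i) <;> simp
    simp only [Set.mem_ofPred_eq, this]
    exact ⟨fun h y ↦ by rw [h, map_zero], fun h ↦ MvPolynomial.funext fun y ↦ by simp [h y]⟩
  rw [h]
  exact isClosed_iInter fun y ↦ isClosed_eval_eq_zero _

/-- The set of parameters over which the fiber of a constructible set is dense is constructible. -/
theorem IsConstructibleIn.setOf_dense_fiber [Infinite K] [Finite σ] [Finite τ]
    {T : Set (σ ⊕ τ → K)} (hT : IsConstructibleIn (zariskiTopology K (σ ⊕ τ)) T) :
    IsConstructibleIn (zariskiTopology K σ)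
      {a | ∀ q : MvPolynomial τ K, (∀ y, Sum.elim a y ∈ T → eval y q = 0) → q = 0} := by
  obtain ⟨W, hW, rfl⟩ := hT.exists_preimage_pointToPoint
  obtain ⟨S, rfl⟩ := PrimeSpectrum.exists_constructibleSetData_iff.2 hW
  convert! isConstructibleIn_biUnion_finset S
    (C := fun B ↦ ⋂ j, {a : σ → K | fiberPoly (τ := τ) a (B.g j) = 0})
    (D := fun B ↦ {a | fiberPoly a B.f = 0})
    (fun B _ ↦ isClosed_iInter fun j ↦ isClosed_fiberPoly_eq_zero _)
    (fun B _ ↦ isClosed_fiberPoly_eq_zero _)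
  ext a
  simp only [Set.mem_ofPred_eq, Set.mem_preimage, PrimeSpectrum.ConstructibleSetData.toSet,
    Set.mem_iUnion, pointToPoint_mem_toSet, Set.mem_sdiff, Set.mem_iInter, exists_prop,
    ← eval_fiberPoly]
  constructor
  · intro h
    by_contra! hcon
    have : ∀ B ∈ S, ∃ q : MvPolynomial τ K, q ≠ 0 ∧ ∀ y : τ → K,
        (∀ j, eval y (fiberPoly a (B.g j)) = 0) → eval y (fiberPoly a B.f) ≠ 0 →
          eval y q = 0 := by
      intro B hB
      by_cases hg : ∀ j, fiberPoly (τ := τ) a (B.g j) = 0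
      · refine ⟨1, one_ne_zero, fun y _ hy ↦ (hy ?_).elim⟩
        rw [hcon B hB hg, map_zero]
      · push Not at hg
        obtain ⟨j, hj⟩ := hg
        exact ⟨_, hj, fun y hy _ ↦ hy j⟩
    choose! q hq0 hq using this
    refine Finset.prod_ne_zero_iff.2 hq0 (h (∏ B ∈ S, q B) ?_)
    rintro y ⟨B, hB, hy, hy'⟩
    rw [map_prod]
    exact Finset.prod_eq_zero hB (hq B hB y hy hy')
  · rintro ⟨B, hB, hg, hf⟩ q hq
    have : q * fiberPoly a B.f = 0 := by
      refine MvPolynomial.funext fun y ↦ ?_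
      rw [map_mul, map_zero, mul_eq_zero, or_iff_not_imp_right]
      exact fun hy ↦ hq y ⟨B, hB, fun j ↦ by rw [hg, map_zero], hy⟩
    exact (mul_eq_zero.1 this).resolve_right hf

theorem le_ringKrullDim_quotient_vanishingIdeal_iff [Finite σ] {S : Set (σ → K)} {d : ℕ} :
    (d : WithBot ℕ∞) ≤ ringKrullDim (MvPolynomial σ K ⧸ vanishingIdeal K S) ↔
      ∃ i : Fin d ↪ σ, ∀ q : MvPolynomial (Fin d) K, (∀ x ∈ S, eval (x ∘ i) q = 0) → q = 0 := by
  have key (i : Fin d ↪ σ) (q : MvPolynomial (Fin d) K) :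
      rename i q ∈ vanishingIdeal K S ↔ ∀ x ∈ S, eval (x ∘ i) q = 0 := by
    simp [mem_vanishingIdeal_iff, aeval_eq_eval, eval_rename]
  simp only [← key]
  exact ⟨exists_embedding_of_le_ringKrullDim_quotient,
    fun ⟨i, hi⟩ ↦ le_ringKrullDim_quotient_of_embedding hi⟩

theorem IsConstructibleIn.setOf_le_ringKrullDim [IsAlgClosed K] [Finite σ] [Finite τ]
    {S : Set (σ ⊕ τ → K)} (hS : IsConstructibleIn (zariskiTopology K (σ ⊕ τ)) S) (d : ℕ) :
    IsConstructibleIn (zariskiTopology K σ)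
      {a | (d : WithBot ℕ∞) ≤
        ringKrullDim (MvPolynomial τ K ⧸ vanishingIdeal K {x | Sum.elim a x ∈ S})} := by
  simp only [le_ringKrullDim_quotient_vanishingIdeal_iff, Set.ofPred_exists]
  refine .iUnion_zariski fun i ↦ ?_
  convert! (hS.image_comp (Sum.map id i)).setOf_dense_fiber using 4 with a q
  refine imp_congr_left ⟨?_, ?_⟩
  · rintro h y ⟨x, hx, hxy⟩
    have hxa : x = Sum.elim a (x ∘ Sum.inr) := by
      ext (j | j)
      · simpa using congrFun hxy (Sum.inl j)
      · rfl
    have hy : y = (x ∘ Sum.inr) ∘ i := funext fun j ↦ (congrFun hxy (Sum.inr j)).symm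
    rw [hy]
    exact h _ (by rwa [Set.mem_ofPred_eq, ← hxa])
  · intro h x hx
    refine h _ ⟨_, hx, ?_⟩
    ext (j | j) <;> rfl

end ZariskiSpectrum

/-- Dimension is definable in families over an algebraically closed field: if
`S ⊆ K^m × K^n` is constructible, then for every `d` the set of parameters `a`
such that `S_a` is nonempty and the Krull dimension of the Zariski closure of
`S_a` equals `d` is a constructible subset of `K^m`. -/
theorem dimension_definable_in_families
    {K : Type*} [Field K] [IsAlgClosed K] (m n : ℕ)
    (S : Set (Fin m ⊕ Fin n → K))
    (hS : IsConstructibleIn (zariskiTopology K (Fin m ⊕ Fin n)) S) :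
    ∀ d : ℕ, IsConstructibleIn (zariskiTopology K (Fin m))
      {a : Fin m → K |
        {x : Fin n → K | Sum.elim a x ∈ S}.Nonempty ∧
        krullDimOf (zariskiTopology K (Fin n))
          (@closure _ (zariskiTopology K (Fin n))
            {x : Fin n → K | Sum.elim a x ∈ S}) = (d : ℕ∞) } := by
  intro d
  convert! (hS.setOf_le_ringKrullDim d).sdiff_zariski (hS.setOf_le_ringKrullDim (d + 1)) using 1
  ext a
  rw [Set.mem_ofPred_eq, krullDimOf_closure, Set.mem_sdiff, Set.mem_ofPred_eq, Set.mem_ofPred_eq]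
  generalize hx : ringKrullDim (MvPolynomial (Fin n) K ⧸
    MvPolynomial.vanishingIdeal K {x | Sum.elim a x ∈ S}) = x
  have hne : ((d : ℕ) : WithBot ℕ∞) ≤ x → {x | Sum.elim a x ∈ S}.Nonempty := by
    intro hd
    by_contra! hempty
    rw [← hx, le_ringKrullDim_quotient_vanishingIdeal_iff, hempty] at hd
    obtain ⟨i, hi⟩ := hd
    exact one_ne_zero (hi 1 (by simp))
  rw [Nat.cast_add, Nat.cast_one, ENat.WithBot.add_one_le_iff, not_lt, ← ge_antisymm_iff]
  exact ⟨fun h ↦ h.2, fun h ↦ ⟨hne h.ge, h⟩⟩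
end

section
/- Let K be an algebraically closed field, let S ⊆ K^m × K^n be a constructible set with respect to the Zariski topology on K^{m+n}, and let A ⊆ K^m be a constructible set such that for every a ∈ A the Zariski closure of S_a in K^n equals the zero locus { x ∈ K^n : F(x) = 0 } of some irreducible polynomial F ∈ K[y₁, …, yₙ]. Then: (i) there exists D ∈ ℕ such that for every a ∈ A, the closure of S_a is the zero locus of an irreducible polynomial of total degree at most D; and (ii) for every i with 1 ≤ i ≤ n and every e ∈ ℕ, the set { a ∈ A : the closure of S_a equals the zero locus of some irreducible F ∈ K[y₁, …, yₙ] whose degree in the variable y_i equals e } is a constructible subset of K^m. (This is Theorem A.6(4) of the paper's appendix: when the Zariski closure is an irreducible hypersurface, the degrees of its defining polynomial are bounded and definable in families.) -/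
section ZariskiSpectrum

open MvPolynomial Topology

variable {K : Type*} [Field K] {σ τ : Type*}

/-- The point of the prime spectrum attached to a point of affine space. -/
noncomputable abbrev toSpec (x : σ → K) : PrimeSpectrum (MvPolynomial σ K) :=
  pointToPoint (k := K) x

lemma mem_toSpec {x : σ → K} {p : MvPolynomial σ K} :
    p ∈ (toSpec x).asIdeal ↔ eval x p = 0 := by
  simp [toSpec, pointToPoint]

lemma toSpec_comp (f : σ → τ) (x : τ → K) :
    toSpec (x ∘ f) = PrimeSpectrum.comap (rename f : _ →ₐ[K] _).toRingHom (toSpec x) := by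
  ext p
  simp [mem_toSpec, PrimeSpectrum.comap_asIdeal, Ideal.mem_comap, eval_rename]

lemma zariskiTopology_eq_induced :
    zariskiTopology K σ = TopologicalSpace.induced toSpec inferInstance := by
  rw [PrimeSpectrum.isTopologicalBasis_basic_opens.eq_generateFrom, induced_generateFrom_eq,
    zariskiTopology]
  refine congrArg _ (Set.ext fun U ↦ ?_)
  simp only [Set.mem_ofPred_eq, Set.mem_image, Set.mem_range, exists_exists_eq_and]
  refine exists_congr fun f ↦ ?_
  have : toSpec ⁻¹' (PrimeSpectrum.basicOpen f : Set (PrimeSpectrum (MvPolynomial σ K))) =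
      {x | eval x f ≠ 0} := by ext; simp [mem_toSpec]
  rw [this, eq_comm]

lemma isClosed_zariski_iff_preimage {C : Set (σ → K)} :
    @IsClosed _ (zariskiTopology K σ) C ↔ ∃ Z, IsClosed Z ∧ toSpec ⁻¹' Z = C := by
  rw [zariskiTopology_eq_induced, isClosed_induced_iff]

lemma isClosed_zariski_iff {C : Set (σ → K)} :
    @IsClosed _ (zariskiTopology K σ) C ↔
      ∃ I : Set (MvPolynomial σ K), C = {x | ∀ p ∈ I, eval x p = 0} := by
  rw [isClosed_zariski_iff_preimage]
  simp only [PrimeSpectrum.isClosed_iff_zeroLocus]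
  constructor
  · rintro ⟨_, ⟨I, rfl⟩, rfl⟩
    exact ⟨I, by ext; simp [Set.subset_def, mem_toSpec]⟩
  · rintro ⟨I, rfl⟩
    exact ⟨_, ⟨I, rfl⟩, by ext; simp [Set.subset_def, mem_toSpec]⟩

/-- A polynomial vanishes on a set iff it vanishes on its Zariski closure. -/
lemma forall_mem_closure_eval_eq_zero {T : Set (σ → K)} {F : MvPolynomial σ K} :
    (∀ x ∈ @closure _ (zariskiTopology K σ) T, eval x F = 0) ↔ ∀ x ∈ T, eval x F = 0 := by
  let := zariskiTopology K σ
  refine ⟨fun h x hx ↦ h x (subset_closure hx), fun h ↦ ?_⟩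
  exact closure_minimal (t := {x | eval x F = 0}) h
    (isClosed_zariski_iff.2 ⟨{F}, by simp⟩)

lemma isConstructibleIn_iff_isConstructible [Finite σ] {S : Set (σ → K)} :
    IsConstructibleIn (zariskiTopology K σ) S ↔
      ∃ Z : Set (PrimeSpectrum (MvPolynomial σ K)), IsConstructible Z ∧ S = toSpec ⁻¹' Z := by
  constructor
  · rintro ⟨r, C, D, hC, hD, rfl⟩
    simp only [isClosed_zariski_iff_preimage] at hC hD
    choose C' hC' hCC using hC
    choose D' hD' hDD using hD
    have key {Z : Set (PrimeSpectrum (MvPolynomial σ K))} (hZ : IsClosed Z) :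
        IsConstructible Z :=
      .of_compl ((TopologicalSpace.NoetherianSpace.isCompact _).isConstructible hZ.isOpen_compl)
    refine ⟨⋃ i, C' i \ D' i, .iUnion fun i ↦ (key (hC' i)).sdiff (key (hD' i)), ?_⟩
    simp [← hCC, ← hDD]
  · rintro ⟨Z, hZ, rfl⟩
    obtain ⟨s, rfl⟩ := PrimeSpectrum.exists_constructibleSetData_iff.2 hZ
    let e := s.equivFin
    refine ⟨s.card, fun i ↦ toSpec ⁻¹' PrimeSpectrum.zeroLocus (Set.range (e.symm i).1.g),
      fun i ↦ toSpec ⁻¹' PrimeSpectrum.zeroLocus {(e.symm i).1.f}, fun i ↦ ?_, fun i ↦ ?_, ?_⟩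
    · exact isClosed_zariski_iff_preimage.2 ⟨_, PrimeSpectrum.isClosed_zeroLocus _, rfl⟩
    · exact isClosed_zariski_iff_preimage.2 ⟨_, PrimeSpectrum.isClosed_zeroLocus _, rfl⟩
    · simp only [PrimeSpectrum.ConstructibleSetData.toSet, Set.preimage_iUnion,
        PrimeSpectrum.BasicConstructibleSetData.toSet, Set.preimage_sdiff]
      ext x
      simp only [Set.mem_iUnion]
      exact ⟨fun ⟨i, hi, h⟩ ↦ ⟨e ⟨i, hi⟩, by rwa [e.symm_apply_apply]⟩,
        fun ⟨j, h⟩ ↦ ⟨_, (e.symm j).2, h⟩⟩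

namespace IsConstructibleIn

variable [Finite σ] {S T : Set (σ → K)}

lemma zariski_compl (hS : IsConstructibleIn (zariskiTopology K σ) S) :
    IsConstructibleIn (zariskiTopology K σ) Sᶜ := by
  obtain ⟨Z, hZ, rfl⟩ := isConstructibleIn_iff_isConstructible.1 hS
  exact isConstructibleIn_iff_isConstructible.2 ⟨Zᶜ, hZ.compl, rfl⟩

lemma zariski_inter (hS : IsConstructibleIn (zariskiTopology K σ) S)
    (hT : IsConstructibleIn (zariskiTopology K σ) T) :
    IsConstructibleIn (zariskiTopology K σ) (S ∩ T) := by
  obtain ⟨Z, hZ, rfl⟩ := isConstructibleIn_iff_isConstructible.1 hS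
  obtain ⟨W, hW, rfl⟩ := isConstructibleIn_iff_isConstructible.1 hT
  exact isConstructibleIn_iff_isConstructible.2 ⟨Z ∩ W, hZ.inter hW, rfl⟩

lemma zariski_iInter {ι : Type*} [Finite ι] {S : ι → Set (σ → K)}
    (hS : ∀ i, IsConstructibleIn (zariskiTopology K σ) (S i)) :
    IsConstructibleIn (zariskiTopology K σ) (⋂ i, S i) := by
  choose Z hZ hSZ using fun i ↦ isConstructibleIn_iff_isConstructible.1 (hS i)
  exact isConstructibleIn_iff_isConstructible.2 ⟨⋂ i, Z i, .iInter hZ, by simp [hSZ, Set.preimage_iInter]⟩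

lemma zariski_preimage [Finite τ] (hS : IsConstructibleIn (zariskiTopology K σ) S) (f : σ → τ) :
    IsConstructibleIn (zariskiTopology K τ) {x : τ → K | x ∘ f ∈ S} := by
  obtain ⟨Z, hZ, rfl⟩ := isConstructibleIn_iff_isConstructible.1 hS
  obtain ⟨s, rfl⟩ := PrimeSpectrum.exists_constructibleSetData_iff.2 hZ
  refine isConstructibleIn_iff_isConstructible.2
    ⟨_, (s.map (rename f : _ →ₐ[K] _).toRingHom).isConstructible_toSet, ?_⟩
  ext x
  simp only [Set.mem_preimage, Set.mem_ofPred_eq, toSpec_comp,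
    PrimeSpectrum.ConstructibleSetData.toSet_map]

end IsConstructibleIn

lemma isConstructibleIn_eval_ne_zero [Finite σ] (p : MvPolynomial σ K) :
    IsConstructibleIn (zariskiTopology K σ) {x | eval x p ≠ 0} :=
  isConstructibleIn_iff_isConstructible.2
    ⟨PrimeSpectrum.basicOpen p, PrimeSpectrum.isConstructible_basicOpen,
      by ext; simp [mem_toSpec]⟩

variable [IsAlgClosed K] [Finite σ] [Finite τ]

/-- Over an algebraically closed field, a point of a constructible set lying above a rational
point can be replaced by a rational point. -/
lemma exists_toSpec_mem_of_isConstructible {Z : Set (PrimeSpectrum (MvPolynomial τ K))}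
    (hZ : IsConstructible Z) {q : PrimeSpectrum (MvPolynomial τ K)} (hq : q ∈ Z) :
    ∃ x : τ → K, toSpec x ∈ Z ∧ q.asIdeal ≤ (toSpec x).asIdeal := by
  obtain ⟨s, rfl⟩ := PrimeSpectrum.exists_constructibleSetData_iff.2 hZ
  simp only [PrimeSpectrum.ConstructibleSetData.toSet, Set.mem_iUnion] at hq ⊢
  obtain ⟨c, hc, hqc⟩ := hq
  have hf : c.f ∉ vanishingIdeal K (zeroLocus K q.asIdeal) := by
    rw [IsPrime.vanishingIdeal_zeroLocus]
    simpa using hqc.2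
  simp only [mem_vanishingIdeal_iff, not_forall] at hf
  obtain ⟨x, hx, hxf⟩ := hf
  have hle : q.asIdeal ≤ (toSpec x).asIdeal := fun p hp ↦ by
    simpa [mem_toSpec] using hx p hp
  refine ⟨x, ⟨c, hc, ?_, ?_⟩, hle⟩
  · exact (show Set.range c.g ⊆ q.asIdeal from hqc.1).trans hle
  · simpa [mem_toSpec] using hxf

/-- **Chevalley's theorem** for projections of affine spaces. -/
lemma IsConstructibleIn.zariski_image {S : Set (τ → K)}
    (hS : IsConstructibleIn (zariskiTopology K τ) S) (f : σ → τ) :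
    IsConstructibleIn (zariskiTopology K σ) {a | ∃ x ∈ S, x ∘ f = a} := by
  obtain ⟨Z, hZ, rfl⟩ := isConstructibleIn_iff_isConstructible.1 hS
  have hfin : (rename f : MvPolynomial σ K →ₐ[K] _).toRingHom.FinitePresentation := by
    rw [← RingHom.FinitePresentation.of_finiteType]
    refine RingHom.FiniteType.of_comp_finiteType (f := (C : K →+* MvPolynomial σ K)) ?_
    have : (rename f : MvPolynomial σ K →ₐ[K] _).toRingHom.comp C =
        algebraMap K (MvPolynomial τ K) := by ext; simp
    rw [this, RingHom.finiteType_algebraMap]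
    infer_instance
  refine isConstructibleIn_iff_isConstructible.2
    ⟨_, PrimeSpectrum.isConstructible_comap_image hfin hZ, ?_⟩
  ext a
  constructor
  · rintro ⟨x, hx, rfl⟩
    exact ⟨_, hx, (toSpec_comp f x).symm⟩
  · rintro ⟨q, hq, hqa⟩
    obtain ⟨x, hx, hle⟩ := exists_toSpec_mem_of_isConstructible hZ hq
    refine ⟨x, hx, ?_⟩
    ext i
    have hmem : X i - C (a i) ∈ (toSpec a).asIdeal := by simp [mem_toSpec]
    rw [← hqa] at hmem
    have := hle hmem
    simpa [mem_toSpec, sub_eq_zero] using this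

end ZariskiSpectrum
section LinearAlgebra

variable {K : Type*} [Field K]

/-- Finitely many functions are linearly independent iff some evaluation matrix is invertible. -/
lemma exists_det_eval_ne_zero_iff {ι X : Type*} [Fintype ι] [DecidableEq ι] (v : X → ι → K) :
    (∃ x : ι → X, (Matrix.of fun i ↦ v (x i)).det ≠ 0) ↔
      ∀ c : ι → K, (∀ x, ∑ i, v x i * c i = 0) → c = 0 := by
  constructor
  · rintro ⟨x, hx⟩ c hc
    exact Matrix.eq_zero_of_mulVec_eq_zero hx (funext fun i ↦ hc (x i))
  · intro h
    have hspan : Submodule.span K (Set.range v) = ⊤ := by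
      by_contra hne
      obtain ⟨f, hf, hle⟩ := Submodule.exists_le_ker_of_lt_top _ (lt_top_iff_ne_top.2 hne)
      refine hf ?_
      have hfv (w : ι → K) : f w = ∑ i, w i * f (Pi.single i 1) := by
        rw [LinearMap.pi_apply_eq_sum_univ f w]
        refine Finset.sum_congr rfl fun i _ ↦ ?_
        rw [smul_eq_mul]
        congr 2
        ext j
        simp [Pi.single_apply, eq_comm]
      have h0 := h (fun i ↦ f (Pi.single i 1)) fun x ↦ by
        rw [← hfv]
        exact hle (Submodule.subset_span ⟨x, rfl⟩)
      ext i
      simpa using congrFun h0 i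
    obtain ⟨f, hf, -, hli⟩ := Submodule.exists_fun_fin_finrank_span_eq K (Set.range v)
    choose x hx using hf
    have hcard : Module.finrank K (Submodule.span K (Set.range v)) = Fintype.card ι := by
      rw [hspan, finrank_top, Module.finrank_fintype_fun_eq_card]
    let e := (Fintype.equivFin ι).trans (finCongr hcard.symm)
    refine ⟨x ∘ e, ?_⟩
    have hrow : LinearIndependent K (Matrix.of fun i ↦ v ((x ∘ e) i)).row := by
      have hcomp : (Matrix.of fun i ↦ v ((x ∘ e) i)).row = f ∘ e := by
        ext i j
        simp [← hx]
      rw [hcomp]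
      exact hli.comp e e.injective
    rw [Matrix.linearIndependent_rows_iff_isUnit, Matrix.isUnit_iff_isUnit_det] at hrow
    exact hrow.ne_zero

end LinearAlgebra

section Families

open MvPolynomial

variable {K : Type*} [Field K] {σ τ : Type*}

/-- Substitute the point `a` for the first block of variables. -/
noncomputable def specializeLeft (a : σ → K) :
    MvPolynomial (σ ⊕ τ) K →ₐ[K] MvPolynomial τ K :=
  aeval (Sum.elim (fun i ↦ C (a i)) X)

lemma eval_specializeLeft (a : σ → K) (x : τ → K) (p : MvPolynomial (σ ⊕ τ) K) :
    eval x (specializeLeft a p) = eval (Sum.elim a x) p := by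
  induction p using MvPolynomial.induction_on with
  | C c => simp [specializeLeft]
  | add p q hp hq => simp [hp, hq]
  | mul_X p i hp =>
    rw [map_mul, map_mul, hp, map_mul]
    cases i <;> simp [specializeLeft]

lemma exists_totalDegree_specializeLeft_le (p : MvPolynomial (σ ⊕ τ) K) :
    ∃ D : ℕ, ∀ a : σ → K, (specializeLeft a p).totalDegree ≤ D := by
  induction p using MvPolynomial.induction_on with
  | C c => exact ⟨0, fun a ↦ by simp [specializeLeft]⟩
  | add p q hp hq =>
    obtain ⟨D, hD⟩ := hp
    obtain ⟨E, hE⟩ := hq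
    refine ⟨max D E, fun a ↦ ?_⟩
    rw [map_add]
    exact (totalDegree_add _ _).trans (max_le_max (hD a) (hE a))
  | mul_X p i hp =>
    obtain ⟨D, hD⟩ := hp
    refine ⟨D + 1, fun a ↦ ?_⟩
    rw [map_mul]
    refine (totalDegree_mul _ _).trans (add_le_add (hD a) ?_)
    cases i <;> simp [specializeLeft]

/-- In a constructible family, fibers lying in a hypersurface lie in one of bounded degree. -/
lemma IsConstructibleIn.exists_totalDegree_le_of_vanishing [Finite σ] [Finite τ] [Infinite K]
    {S : Set (σ ⊕ τ → K)} (hS : IsConstructibleIn (zariskiTopology K (σ ⊕ τ)) S) :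
    ∃ D : ℕ, ∀ (a : σ → K) (G : MvPolynomial τ K), G ≠ 0 →
      (∀ x, Sum.elim a x ∈ S → eval x G = 0) →
      ∃ F : MvPolynomial τ K, F ≠ 0 ∧ F.totalDegree ≤ D ∧
        ∀ x, Sum.elim a x ∈ S → eval x F = 0 := by
  obtain ⟨Z, hZ, rfl⟩ := isConstructibleIn_iff_isConstructible.1 hS
  obtain ⟨s, rfl⟩ := PrimeSpectrum.exists_constructibleSetData_iff.2 hZ
  have hmem (y : σ ⊕ τ → K) (c : PrimeSpectrum.BasicConstructibleSetData _) :
      toSpec y ∈ c.toSet ↔ (∀ j, eval y (c.g j) = 0) ∧ eval y c.f ≠ 0 := by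
    simp [PrimeSpectrum.BasicConstructibleSetData.toSet, Set.range_subset_iff, mem_toSpec]
  choose d hd using exists_totalDegree_specializeLeft_le (K := K) (σ := σ) (τ := τ)
  refine ⟨∑ c ∈ s, ∑ j, d (c.g j), fun a G hG hGS ↦ ?_⟩
  have hpiece (c : PrimeSpectrum.BasicConstructibleSetData _) (hc : c ∈ s) :
      ∃ F : MvPolynomial τ K, F ≠ 0 ∧ F.totalDegree ≤ ∑ j, d (c.g j) ∧
        ∀ x, toSpec (Sum.elim a x) ∈ c.toSet → eval x F = 0 := by
    by_cases hj : ∃ j, specializeLeft a (c.g j) ≠ 0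
    · obtain ⟨j, hj⟩ := hj
      refine ⟨_, hj, (hd _ a).trans
        (Finset.single_le_sum (f := fun j ↦ d (c.g j)) (fun _ _ ↦ Nat.zero_le _)
          (Finset.mem_univ j)), fun x hx ↦ ?_⟩
      rw [eval_specializeLeft]
      exact ((hmem _ _).1 hx).1 j
    · push Not at hj
      refine ⟨1, one_ne_zero, by simp, fun x hx ↦ ?_⟩
      have hmul : specializeLeft a c.f * G = 0 := by
        refine MvPolynomial.funext fun y ↦ ?_
        rw [map_mul, map_zero, mul_eq_zero, or_iff_not_imp_left, eval_specializeLeft]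
        refine fun hy ↦ hGS y ?_
        simp only [Set.mem_preimage, PrimeSpectrum.ConstructibleSetData.toSet, Set.mem_iUnion]
        exact ⟨c, hc, (hmem _ _).2 ⟨fun j ↦ by rw [← eval_specializeLeft, hj, map_zero], hy⟩⟩
      refine absurd ?_ ((hmem _ _).1 hx).2
      rw [← eval_specializeLeft, (mul_eq_zero.1 hmul).resolve_right hG, map_zero]
  choose! F hF0 hFd hF using hpiece
  refine ⟨∏ c ∈ s, F c, Finset.prod_ne_zero_iff.2 hF0,
    (totalDegree_finsetProd _ _).trans (Finset.sum_le_sum hFd), fun x hx ↦ ?_⟩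
  simp only [Set.mem_preimage, PrimeSpectrum.ConstructibleSetData.toSet, Set.mem_iUnion] at hx
  obtain ⟨c, hc, hxc⟩ := hx
  rw [map_prod]
  exact Finset.prod_eq_zero hc (hF c hc x hxc)

/-- The parameters for which the fiber satisfies a nontrivial polynomial equation with prescribed
monomials form a constructible set. -/
lemma IsConstructibleIn.exists_vanishing_support_subset [IsAlgClosed K] [Finite σ] [Finite τ]
    {S : Set (σ ⊕ τ → K)} (hS : IsConstructibleIn (zariskiTopology K (σ ⊕ τ)) S)
    (M : Finset (τ →₀ ℕ)) :
    IsConstructibleIn (zariskiTopology K σ) {a | ∃ F : MvPolynomial τ K, F ≠ 0 ∧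
      F.support ⊆ M ∧ ∀ x, Sum.elim a x ∈ S → eval x F = 0} := by
  classical
  let P : Matrix M M (MvPolynomial (σ ⊕ M × τ) K) :=
    Matrix.of fun i j ↦ rename (fun t ↦ Sum.inr (i, t)) (monomial j.1 (1 : K))
  let T : Set (σ ⊕ M × τ → K) :=
    (⋂ i : M, {y | y ∘ Sum.map id (Prod.mk i) ∈ S}) ∩ {y | eval y P.det ≠ 0}
  have hT : IsConstructibleIn (zariskiTopology K (σ ⊕ M × τ)) T :=
    (zariski_iInter fun i ↦ hS.zariski_preimage _).zariski_inter
      (isConstructibleIn_eval_ne_zero _)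
  convert (hT.zariski_image Sum.inl).zariski_compl using 1
  ext a
  let v (x : {x : τ → K // Sum.elim a x ∈ S}) (j : M) : K := eval x.1 (monomial j.1 1)
  have hTa : (∃ y ∈ T, y ∘ Sum.inl = a) ↔
      ∃ x : M → {x : τ → K // Sum.elim a x ∈ S}, (Matrix.of fun i ↦ v (x i)).det ≠ 0 := by
    have hP (y : σ ⊕ M × τ → K) : eval y P.det =
        (Matrix.of fun (i j : M) ↦
          eval (fun t ↦ y (Sum.inr (i, t))) (monomial j.1 (1 : K))).det := by
      rw [RingHom.map_det]
      congr 1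
      ext i j
      simp only [P, RingHom.mapMatrix_apply, Matrix.map_apply, Matrix.of_apply, eval_rename]
      rfl
    have hcomp (y : σ ⊕ M × τ → K) (i : M) : y ∘ Sum.map id (Prod.mk i) =
        Sum.elim (y ∘ Sum.inl) (fun t ↦ y (Sum.inr (i, t))) := by
      ext (j | j) <;> rfl
    constructor
    · rintro ⟨y, ⟨hyS, hy⟩, rfl⟩
      simp only [Set.mem_iInter, Set.mem_ofPred_eq, hcomp] at hyS
      rw [Set.mem_ofPred_eq, hP] at hy
      exact ⟨fun i ↦ ⟨_, hyS i⟩, hy⟩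
    · rintro ⟨x, hx⟩
      refine ⟨Sum.elim a fun q ↦ (x q.1).1 q.2, ⟨?_, ?_⟩, rfl⟩
      · simp only [Set.mem_iInter, Set.mem_ofPred_eq, hcomp]
        exact fun i ↦ (x i).2
      · rw [Set.mem_ofPred_eq, hP]
        exact hx
  rw [Set.mem_compl_iff, Set.mem_ofPred_eq, Set.mem_ofPred_eq, hTa, exists_det_eval_ne_zero_iff]
  push Not
  have hsum (c : M → K) (x : τ → K) :
      eval x (∑ j : M, monomial j.1 (c j)) = ∑ j : M, eval x (monomial j.1 1) * c j := by
    simp [eval_monomial, mul_comm]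
  constructor
  · rintro ⟨F, hF0, hFM, hF⟩
    have hFsum : F = ∑ j : M, monomial j.1 (coeff j.1 F) := by
      conv_lhs => rw [F.as_sum]
      rw [Finset.sum_coe_sort M fun j ↦ monomial j (coeff j F)]
      exact Finset.sum_subset hFM fun j _ hj ↦ by simp [notMem_support_iff.1 hj]
    refine ⟨fun j ↦ coeff j.1 F, fun x ↦ ?_, fun h ↦ hF0 ?_⟩
    · rw [← hF x.1 x.2, hFsum, hsum, ← hFsum]
    · rw [hFsum]
      exact Finset.sum_eq_zero fun j _ ↦ by
        rw [show coeff j.1 F = 0 from congrFun h j, map_zero]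
  · rintro ⟨c, hc, hc0⟩
    have hcoeff (i : M) : coeff i.1 (∑ j : M, monomial j.1 (c j)) = c i := by
      simp [coeff_sum, coeff_monomial]
    refine ⟨∑ j : M, monomial j.1 (c j), fun h ↦ hc0 ?_, fun i hi ↦ ?_, fun x hx ↦ ?_⟩
    · ext i
      rw [← hcoeff, h, coeff_zero, Pi.zero_apply]
    · by_contra hiM
      refine mem_support_iff.1 hi ?_
      rw [coeff_sum]
      refine Finset.sum_eq_zero fun j _ ↦ ?_
      rw [coeff_monomial, if_neg]
      rintro rfl
      exact hiM j.2
    · rw [hsum]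
      exact hc ⟨x, hx⟩

/-- If the closure of `T` is an irreducible hypersurface, its equation generates the ideal of
polynomials vanishing on `T`. -/
lemma Irreducible.dvd_iff_vanishing_of_closure_eq [IsAlgClosed K] [Finite τ] {T : Set (τ → K)}
    {G : MvPolynomial τ K} (hG : Irreducible G)
    (hT : @closure _ (zariskiTopology K τ) T = {x | eval x G = 0}) {F : MvPolynomial τ K} :
    G ∣ F ↔ ∀ x ∈ T, eval x F = 0 := by
  rw [← forall_mem_closure_eval_eq_zero, hT]
  have : (Ideal.span {G}).IsPrime := (Ideal.span_singleton_prime hG.ne_zero).2 hG.prime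
  rw [← Ideal.mem_span_singleton, ← IsPrime.vanishingIdeal_zeroLocus (K := K) (Ideal.span {G})]
  simp [zeroLocus_span, mem_vanishingIdeal_iff]

lemma MvPolynomial.degreeOf_le_of_dvd {i : τ} {G F : MvPolynomial τ K} (h : G ∣ F) (hF : F ≠ 0) :
    degreeOf i G ≤ degreeOf i F := by
  obtain ⟨H, rfl⟩ := h
  rw [degreeOf_mul_eq (left_ne_zero_of_mul hF) (right_ne_zero_of_mul hF)]
  exact Nat.le_add_right _ _

lemma MvPolynomial.degreeOf_lt_iff_of_ne_zero {i : τ} {F : MvPolynomial τ K} (hF : F ≠ 0) {e : ℕ} :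
    degreeOf i F < e ↔ ∀ u ∈ F.support, u i < e := by
  rcases e.eq_zero_or_pos with rfl | he
  · obtain ⟨u, hu⟩ := support_nonempty.2 hF
    simpa using ⟨u, mem_support_iff.1 hu⟩
  · exact degreeOf_lt_iff he

end Families

/-- When the Zariski closures of the fibers of a constructible family are
irreducible hypersurfaces, the defining irreducible polynomials have uniformly
bounded total degree, and their degree in each fixed variable is definable in
families. -/
theorem hypersurface_degree_definable_in_families
    {K : Type*} [Field K] [IsAlgClosed K] (m n : ℕ)
    (S : Set (Fin m ⊕ Fin n → K))
    (hS : IsConstructibleIn (zariskiTopology K (Fin m ⊕ Fin n)) S)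
    (A : Set (Fin m → K))
    (hA : IsConstructibleIn (zariskiTopology K (Fin m)) A)
    (hhyp : ∀ a ∈ A, ∃ F : MvPolynomial (Fin n) K, Irreducible F ∧
      @closure _ (zariskiTopology K (Fin n)) {x : Fin n → K | Sum.elim a x ∈ S} =
        {x : Fin n → K | MvPolynomial.eval x F = 0}) :
    (∃ D : ℕ, ∀ a ∈ A, ∃ F : MvPolynomial (Fin n) K, Irreducible F ∧
        F.totalDegree ≤ D ∧
        @closure _ (zariskiTopology K (Fin n))
            {x : Fin n → K | Sum.elim a x ∈ S} =
          {x : Fin n → K | MvPolynomial.eval x F = 0}) ∧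
      ∀ (i : Fin n) (e : ℕ), IsConstructibleIn (zariskiTopology K (Fin m))
        {a : Fin m → K | a ∈ A ∧
          ∃ F : MvPolynomial (Fin n) K, Irreducible F ∧
            MvPolynomial.degreeOf i F = e ∧
            @closure _ (zariskiTopology K (Fin n))
                {x : Fin n → K | Sum.elim a x ∈ S} =
              {x : Fin n → K | MvPolynomial.eval x F = 0}} := by
  classical
  obtain ⟨D, hD⟩ := hS.exists_totalDegree_le_of_vanishing
  have hbound {a : Fin m → K} {G : MvPolynomial (Fin n) K} (hG : Irreducible G)
      (hGa : @closure _ (zariskiTopology K (Fin n)) {x : Fin n → K | Sum.elim a x ∈ S} =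
        {x : Fin n → K | MvPolynomial.eval x G = 0}) : G.totalDegree ≤ D := by
    obtain ⟨F, hF0, hFD, hF⟩ := hD a G hG.ne_zero
      ((hG.dvd_iff_vanishing_of_closure_eq hGa).1 dvd_rfl)
    exact (MvPolynomial.totalDegree_le_of_dvd_of_isDomain
      ((hG.dvd_iff_vanishing_of_closure_eq hGa).2 hF) hF0).trans hFD
  refine ⟨⟨D, fun a ha ↦ ?_⟩, fun i e ↦ ?_⟩
  · obtain ⟨G, hG, hGa⟩ := hhyp a ha
    exact ⟨G, hG, hbound hG hGa, hGa⟩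
  let M (k : ℕ) : Finset (Fin n →₀ ℕ) :=
    (Finsupp.finite_of_degree_le D).toFinset.filter fun u ↦ u i < k
  have hL (k : ℕ) := hS.exists_vanishing_support_subset (M k)
  have hLiff {a : Fin m → K} {G : MvPolynomial (Fin n) K} (hG : Irreducible G)
      (hGa : @closure _ (zariskiTopology K (Fin n)) {x : Fin n → K | Sum.elim a x ∈ S} =
        {x : Fin n → K | MvPolynomial.eval x G = 0}) (k : ℕ) :
      (∃ F : MvPolynomial (Fin n) K, F ≠ 0 ∧ F.support ⊆ M k ∧
        ∀ x, Sum.elim a x ∈ S → MvPolynomial.eval x F = 0) ↔ MvPolynomial.degreeOf i G < k := by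
    constructor
    · rintro ⟨F, hF0, hFM, hF⟩
      refine (MvPolynomial.degreeOf_le_of_dvd
        ((hG.dvd_iff_vanishing_of_closure_eq hGa).2 hF) hF0).trans_lt ?_
      rw [MvPolynomial.degreeOf_lt_iff_of_ne_zero hF0]
      exact fun u hu ↦ (Finset.mem_filter.1 (hFM hu)).2
    · intro hk
      refine ⟨G, hG.ne_zero, fun u hu ↦ Finset.mem_filter.2 ⟨?_, ?_⟩,
        (hG.dvd_iff_vanishing_of_closure_eq hGa).1 dvd_rfl⟩
      · exact (Set.Finite.mem_toFinset _).2
          ((MvPolynomial.le_totalDegree hu).trans (hbound hG hGa))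
      · exact (MvPolynomial.degreeOf_lt_iff_of_ne_zero hG.ne_zero).1 hk u hu
  convert (hA.zariski_inter (hL (e + 1))).zariski_inter (hL e).zariski_compl using 1
  ext a
  simp only [Set.mem_inter_iff, Set.mem_compl_iff, Set.mem_ofPred_eq, and_assoc]
  refine and_congr_right fun ha ↦ ?_
  constructor
  · rintro ⟨G, hG, hGe, hGa⟩
    rw [hLiff hG hGa, hLiff hG hGa]
    omega
  · intro h
    obtain ⟨G, hG, hGa⟩ := hhyp a ha
    rw [hLiff hG hGa, hLiff hG hGa] at h
    exact ⟨G, hG, by omega, hGa⟩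
end

section
/- Let K be an algebraically closed field and let S ⊆ K^m × K^n be a constructible set with respect to the Zariski topology on K^{m+n}. Then for every k ∈ ℕ, the set { (a, x) ∈ K^m × K^n : x lies in exactly k irreducible components of the Zariski closure of S_a in K^n } is a constructible subset of K^m × K^n. (This is a precise rendering of Theorem A.6(5) of the paper's appendix: the family of irreducible components of the Zariski closure is definable in families.) -/
/-- The irreducible components of a (closed) subset `C` of a topological space:
the maximal irreducible closed subsets contained in `C`. -/
def irredComps {α : Type*} (t : TopologicalSpace α) (C : Set α) : Set (Set α) :=
  {T | Maximal (fun T => T ⊆ C ∧ @IsClosed _ t T ∧ @IsIrreducible _ t T) T}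

open MvPolynomial

/-- A specialization from a field `L` to a field `K`: a surjective ring homomorphism to `K`
defined on a subring of `L`. -/
structure RingSpecialization (L K : Type*) [Field L] [Field K] where
  /-- The subring on which the specialization is defined. -/
  R : Subring L
  /-- The underlying ring homomorphism. -/
  φ : R →+* K
  surj : Function.Surjective φ

namespace RingSpecialization

variable {L K τ : Type*} [Field L] [Field K]

/-- The filter of sufficiently generic specializations: those defined at any prescribed finite
set of elements of `L`. -/
def generic (L K : Type*) [Field L] [Field K] : Filter (RingSpecialization L K) where
  sets := {S | ∃ F : Finset L, ∀ s : RingSpecialization L K, (F : Set L) ⊆ s.R → s ∈ S}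
  univ_sets := ⟨∅, fun _ _ => trivial⟩
  sets_of_superset := fun ⟨F, hF⟩ h => ⟨F, fun s hs => h (hF s hs)⟩
  inter_sets := by
    classical
    rintro S T ⟨F, hF⟩ ⟨G, hG⟩
    refine ⟨F ∪ G, fun s hs => ?_⟩
    rw [Finset.coe_union, Set.union_subset_iff] at hs
    exact ⟨hF s hs.1, hG s hs.2⟩

theorem eventually_generic_iff {P : RingSpecialization L K → Prop} :
    (∀ᶠ s in generic L K, P s) ↔
      ∃ F : Finset L, ∀ s : RingSpecialization L K, (F : Set L) ⊆ s.R → P s := Iff.rfl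

theorem eventually_mem (c : L) : ∀ᶠ s in generic L K, c ∈ s.R :=
  eventually_generic_iff.2 ⟨{c}, fun s hs => by simpa using hs⟩

/-- The inclusion of polynomials over the domain of `s` into polynomials over `L`. -/
noncomputable abbrev incl (s : RingSpecialization L K) : MvPolynomial τ s.R →+* MvPolynomial τ L :=
  map s.R.subtype

/-- The reduction of polynomials over the domain of `s` to polynomials over `K`. -/
noncomputable abbrev red (s : RingSpecialization L K) : MvPolynomial τ s.R →+* MvPolynomial τ K :=
  map s.φ

theorem incl_injective (s : RingSpecialization L K) :
    Function.Injective (s.incl : MvPolynomial τ s.R →+* MvPolynomial τ L) :=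
  map_injective _ Subtype.val_injective

theorem red_surjective (s : RingSpecialization L K) :
    Function.Surjective (s.red : MvPolynomial τ s.R →+* MvPolynomial τ K) :=
  map_surjective _ s.surj

/-- The restriction of an ideal to polynomials over the domain of `s`. -/
noncomputable abbrev restrict (s : RingSpecialization L K) (I : Ideal (MvPolynomial τ L)) :
    Ideal (MvPolynomial τ s.R) :=
  I.comap s.incl

/-- The specialization of an ideal. -/
noncomputable abbrev special (s : RingSpecialization L K) (I : Ideal (MvPolynomial τ L)) :
    Ideal (MvPolynomial τ K) :=
  (s.restrict I).map s.red

theorem mem_special (s : RingSpecialization L K) {I : Ideal (MvPolynomial τ L)}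
    {p : MvPolynomial τ K} : p ∈ s.special I ↔ ∃ q, s.incl q ∈ I ∧ s.red q = p := by
  rw [Ideal.mem_map_iff_of_surjective _ s.red_surjective]
  rfl

theorem eventually_lift (p : MvPolynomial τ L) : ∀ᶠ s in generic L K, ∃ q, s.incl q = p := by
  classical
  refine eventually_generic_iff.2 ⟨p.support.image (fun d => p.coeff d), fun s hs => ?_⟩
  change p ∈ Set.range (map s.R.subtype)
  have := (mem_range_map_iff_coeffs_subset (f := s.R.subtype) (x := p)).2 ?_
  · simpa using this
  · intro c hc
    obtain ⟨d, hd, rfl⟩ := mem_coeffs_iff.1 hc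
    simpa using hs (Finset.mem_coe.2 (Finset.mem_image_of_mem _ hd))

theorem eventually_lift_finset (F : Finset (MvPolynomial τ L)) :
    ∀ᶠ s in generic L K, ∀ p ∈ F, ∃ q, s.incl q = p :=
  (Filter.eventually_all_finset F).2 fun p _ => eventually_lift p

end RingSpecialization


theorem exists_monomialOrder.{u} (τ : Type u) [Finite τ] : Nonempty (MonomialOrder.{u, u} τ) := by
  let := LinearOrder.lift' (Finite.equivFin τ) (Finite.equivFin τ).injective
  exact ⟨MonomialOrder.lex⟩

/-- Existence of finite monic Gröbner bases. -/
theorem MonomialOrder.exists_finset_monic_degree_le {L τ : Type*} [Field L] [Finite τ]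
    (m : MonomialOrder τ) (I : Ideal (MvPolynomial τ L)) :
    ∃ B : Finset (MvPolynomial τ L), (∀ b ∈ B, b ∈ I ∧ m.Monic b) ∧
      ∀ f ∈ I, f ≠ 0 → ∃ b ∈ B, m.degree b ≤ m.degree f := by
  classical
  let D : Set (τ →₀ ℕ) := {d | ∃ f ∈ I, m.Monic f ∧ m.degree f = d}
  have hfin : {d | Minimal (· ∈ D) d}.Finite :=
    WellQuasiOrderedLE.finite_of_isAntichain (setOfPred_minimal_antichain _)
  have hch : ∀ d : {d // Minimal (· ∈ D) d}, ∃ f ∈ I, m.Monic f ∧ m.degree f = d :=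
    fun d => d.2.prop
  choose g hgI hg1 hgd using hch
  have : Fintype {d // Minimal (· ∈ D) d} := hfin.fintype
  refine ⟨Finset.univ.image g, ?_, fun f hf hf0 => ?_⟩
  · intro b hb
    obtain ⟨d, -, rfl⟩ := Finset.mem_image.1 hb
    exact ⟨hgI d, hg1 d⟩
  · have hlc := m.leadingCoeff_ne_zero_iff.2 hf0
    have hu : IsUnit (m.leadingCoeff f)⁻¹ := (inv_ne_zero hlc).isUnit
    have hD : m.degree f ∈ D := by
      refine ⟨C (m.leadingCoeff f)⁻¹ * f, I.mul_mem_left _ hf, ?_, ?_⟩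
      · rw [MonomialOrder.Monic, m.leadingCoeff_mul, m.leadingCoeff_C, inv_mul_cancel₀ hlc]
      · rw [m.degree_mul (by simpa using hf0) hf0, m.degree_C, zero_add]
    obtain ⟨d, hd, hdm⟩ := exists_minimal_le_of_wellFoundedLT (· ∈ D) _ hD
    exact ⟨g ⟨d, hdm⟩, by simp, by rw [hgd]; exact hd⟩

namespace RingSpecialization

variable {L K τ : Type*} [Field L] [Field K]

theorem eventually_mem_span {G : Set (MvPolynomial τ L)} {p : MvPolynomial τ L}
    (hp : p ∈ Ideal.span G) :
    ∀ᶠ s in generic L K, ∀ q, s.incl q = p → q ∈ Ideal.span (s.incl ⁻¹' G) := by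
  induction hp using Submodule.span_induction with
  | mem x hx =>
    refine .of_forall fun s q hq => Ideal.subset_span ?_
    rwa [Set.mem_preimage, hq]
  | zero =>
    refine .of_forall fun s q hq => ?_
    rw [s.incl_injective (hq.trans (map_zero _).symm)]
    exact zero_mem _
  | add x y _ _ hx hy =>
    filter_upwards [hx, hy, eventually_lift x, eventually_lift y] with s h1 h2 ⟨x', hx'⟩ ⟨y', hy'⟩
    intro q hq
    have : q = x' + y' := s.incl_injective (by rw [hq, map_add, hx', hy'])
    rw [this]
    exact add_mem (h1 _ hx') (h2 _ hy')
  | smul a x _ hx =>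
    filter_upwards [hx, eventually_lift a, eventually_lift x] with s h1 ⟨a', ha'⟩ ⟨x', hx'⟩
    intro q hq
    have : q = a' * x' := s.incl_injective (by rw [hq, map_mul, ha', hx', smul_eq_mul])
    rw [this]
    exact Ideal.mul_mem_left _ _ (h1 _ hx')

theorem degree_incl (s : RingSpecialization L K) (m : MonomialOrder τ) (p : MvPolynomial τ s.R) :
    m.degree (s.incl p) = m.degree p := by
  unfold MonomialOrder.degree
  rw [support_map_of_injective _ Subtype.val_injective]

theorem eventually_exists_groebner [Finite τ] (m : MonomialOrder τ)
    (G : Set (MvPolynomial τ L)) :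
    ∀ᶠ s in generic L K, ∃ B : Set (MvPolynomial τ s.R),
      (∀ b ∈ B, s.incl b ∈ Ideal.span G ∧ b ∈ Ideal.span (s.incl ⁻¹' G) ∧
        IsUnit (m.leadingCoeff b)) ∧
      ∀ f, s.incl f ∈ Ideal.span G → f ≠ 0 → ∃ b ∈ B, m.degree b ≤ m.degree f := by
  obtain ⟨B, hB, hB'⟩ := m.exists_finset_monic_degree_le (Ideal.span G)
  have h2 : ∀ᶠ s in generic L K, ∀ b ∈ B, ∀ q, s.incl q = b → q ∈ Ideal.span (s.incl ⁻¹' G) :=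
    (Filter.eventually_all_finset B).2 fun b hb => eventually_mem_span (hB b hb).1
  filter_upwards [h2, eventually_lift_finset B] with s h2 h1
  refine ⟨s.incl ⁻¹' B, fun b hb => ⟨(hB _ hb).1, h2 _ hb _ rfl, ?_⟩, fun f hf hf0 => ?_⟩
  · have := (hB _ hb).2.leadingCoeff_eq_one
    rw [MonomialOrder.leadingCoeff, degree_incl, coeff_map] at this
    have h : m.leadingCoeff b = 1 := Subtype.val_injective this
    rw [h]
    exact isUnit_one
  · obtain ⟨b, hb, hbf⟩ := hB' _ hf ((map_ne_zero_iff _ s.incl_injective).2 hf0)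
    obtain ⟨b', rfl⟩ := h1 b hb
    exact ⟨b', hb, by simpa only [degree_incl] using hbf⟩

/-- Generically, restricting an ideal to the domain of the specialization is compatible with
choosing generators, and it satisfies a flatness property. -/
theorem eventually_restrict_span [Finite τ] (G : Set (MvPolynomial τ L)) :
    ∀ᶠ s in generic L K, s.restrict (Ideal.span G) ≤ Ideal.span (s.incl ⁻¹' G) ∧
      s.restrict (Ideal.span G) ⊓ RingHom.ker s.red ≤
        RingHom.ker s.red * s.restrict (Ideal.span G) := by
  classical
  obtain ⟨m⟩ := exists_monomialOrder τ
  filter_upwards [eventually_exists_groebner m G] with s ⟨B, hB, hB'⟩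
  have hdiv : ∀ f : MvPolynomial τ s.R, ∃ g r, f = g + r ∧ g ∈ Ideal.span B ∧
      ∀ c ∈ r.support, ∀ b ∈ B, ¬ m.degree b ≤ c := by
    intro f
    obtain ⟨g, r, h1, -, h3⟩ := m.div_set (fun b hb => (hB b hb).2.2) f
    refine ⟨_, r, h1, ?_, h3⟩
    have := (Finsupp.mem_ideal_span_range_iff_exists_finsupp
      (v := fun b : B => (b : MvPolynomial τ s.R))
      (x := Finsupp.linearCombination _ (fun b : B ↦ (b : MvPolynomial τ s.R)) g)).2 ⟨g, ?_⟩
    · simpa using this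
    · simp [Finsupp.linearCombination_apply]
  have hstd : ∀ r : MvPolynomial τ s.R, r ∈ s.restrict (Ideal.span G) →
      (∀ c ∈ r.support, ∀ b ∈ B, ¬ m.degree b ≤ c) → r = 0 := by
    intro r hr h
    by_contra h0
    obtain ⟨b, hb, hbr⟩ := hB' r hr h0
    exact h _ (m.degree_mem_support h0) b hb hbr
  have hBI : Ideal.span B ≤ s.restrict (Ideal.span G) := Ideal.span_le.2 fun b hb => (hB b hb).1
  have hBG : Ideal.span B ≤ Ideal.span (s.incl ⁻¹' G) := Ideal.span_le.2 fun b hb => (hB b hb).2.1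
  refine ⟨fun f hf => ?_, fun e he => ?_⟩
  · obtain ⟨g, r, rfl, hg, hr⟩ := hdiv f
    have : r = 0 := hstd r (by simpa using sub_mem hf (hBI hg)) hr
    simpa [this] using hBG hg
  · obtain ⟨heI, heK⟩ := he
    choose g r hgr hg hr using fun d : τ →₀ ℕ => hdiv (monomial d 1)
    have he : e = ∑ d ∈ e.support, C (coeff d e) * g d + ∑ d ∈ e.support, C (coeff d e) * r d := by
      rw [← Finset.sum_add_distrib]
      conv_lhs => rw [e.as_sum]
      refine Finset.sum_congr rfl fun d _ => ?_
      rw [← mul_add, ← hgr, C_mul_monomial, mul_one]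
    have hker : ∀ d, (C (coeff d e) : MvPolynomial τ s.R) ∈ RingHom.ker s.red := by
      intro d
      have := congrArg (coeff d) (show s.red e = 0 from heK)
      rw [coeff_map, coeff_zero] at this
      rw [RingHom.mem_ker, map_C, this, C_0]
    have hgI : ∑ d ∈ e.support, C (coeff d e) * g d ∈ s.restrict (Ideal.span G) :=
      sum_mem fun d _ => Ideal.mul_mem_left _ _ (hBI (hg d))
    have h0 : ∑ d ∈ e.support, C (coeff d e) * r d = 0 := by
      refine hstd _ ?_ ?_
      · have := sub_mem heI hgI
        rwa [sub_eq_of_eq_add' he] at this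
      · intro c hc
        obtain ⟨d, -, hd⟩ := Finset.mem_biUnion.1 (support_sum hc)
        exact hr d c (mem_support_iff.2 fun h => by simp [coeff_C_mul, h] at hd)
    rw [he, h0, add_zero]
    exact sum_mem fun d _ => Ideal.mul_mem_mul (hker d) (hBI (hg d))

theorem eventually_special_span_le [Finite τ] (G : Set (MvPolynomial τ L)) :
    ∀ᶠ s in generic L K, s.special (Ideal.span G) ≤ Ideal.span (s.red '' (s.incl ⁻¹' G)) :=
  (eventually_restrict_span G).mono fun s hs => by
    rw [← Ideal.map_span]
    exact Ideal.map_mono hs.1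

/-- An element is generically outside a specialized ideal if it is not in the radical. -/
theorem eventually_red_notMem_special [IsAlgClosed L] [Finite τ] {I : Ideal (MvPolynomial τ L)}
    {h : MvPolynomial τ L} (hh : h ∉ I.radical) :
    ∀ᶠ s in generic L K, ∀ q, s.incl q = h → s.red q ∉ s.special I := by
  have := Fintype.ofFinite τ
  classical
  rw [← vanishingIdeal_zeroLocus_eq_radical (K := L), mem_vanishingIdeal_iff] at hh
  push Not at hh
  obtain ⟨x, hx, hxh⟩ := hh
  have h1 : ∀ᶠ s in generic L K, ∀ i : τ, x i ∈ s.R :=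
    Filter.eventually_all.2 fun i => eventually_mem _
  filter_upwards [h1, eventually_mem (aeval x h)⁻¹] with s hs1 hs2 q hq hqI
  obtain ⟨p, hpI, hp⟩ := s.mem_special.1 hqI
  let x' : τ → s.R := fun i => ⟨x i, hs1 i⟩
  have key : ∀ p : MvPolynomial τ s.R, ((eval x' p : s.R) : L) = aeval x (s.incl p) := by
    intro p
    rw [aeval_def, eval₂_map]
    change s.R.subtype (eval x' p) = _
    rw [← eval₂_id, hom_eval₂]
    rfl
  have keyφ : ∀ p : MvPolynomial τ s.R, s.φ (eval x' p) = eval (s.φ ∘ x') (s.red p) := by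
    intro p
    rw [eval_map, ← eval₂_id, hom_eval₂]
    rfl
  have h1 : (eval x' q) * (⟨_, hs2⟩ : s.R) = 1 := by
    apply Subtype.val_injective
    push_cast
    rw [key, hq]
    exact mul_inv_cancel₀ hxh
  have h2 : eval x' p = 0 := by
    apply Subtype.val_injective
    rw [key]
    exact hx _ hpI
  have h3 : s.φ (eval x' q) = 0 := by
    rw [keyφ, ← hp, ← keyφ, h2, map_zero]
  simpa [h3] using congrArg s.φ h1

theorem eventually_mem_special_of_mul_mem [Finite τ] {P : Ideal (MvPolynomial τ L)}
    [P.IsPrime] {h : MvPolynomial τ L} (hh : h ∉ P) :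
    ∀ᶠ s in generic L K, ∀ q, s.incl q = h → ∀ p, s.red q * p ∈ s.special P → p ∈ s.special P := by
  have h1 := eventually_restrict_span (K := K) ((P : Set (MvPolynomial τ L)) ∪ {h})
  filter_upwards [h1] with s ⟨hs1, hs2⟩ q hq p hp
  obtain ⟨p, rfl⟩ := s.red_surjective p
  rw [← map_mul] at hp
  obtain ⟨g, hgP, hg⟩ := s.mem_special.1 hp
  have hle : s.restrict (Ideal.span (P ∪ {h})) ≤ s.restrict P ⊔ Ideal.span {q} := by
    refine hs1.trans (Ideal.span_le.2 ?_)
    rintro f (hf | hf)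
    · exact Ideal.mem_sup_left hf
    · rw [s.incl_injective (hf.trans hq.symm)]
      exact Ideal.mem_sup_right (Ideal.subset_span rfl)
  have he : q * p - g ∈ s.restrict (Ideal.span (P ∪ {h})) ⊓ RingHom.ker s.red := by
    constructor
    · refine sub_mem (Ideal.mul_mem_right _ _ ?_) ?_
      · exact Ideal.subset_span (Or.inr hq)
      · exact Ideal.subset_span (Or.inl hgP)
    · rw [SetLike.mem_coe, RingHom.mem_ker, map_sub, hg, sub_self]
  have := Ideal.mul_mono_right hle (hs2 he)
  rw [Ideal.mul_sup, Submodule.mem_sup] at this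
  obtain ⟨a, ha, b, hb, hab⟩ := this
  rw [mul_comm, Ideal.mem_span_singleton_mul] at hb
  obtain ⟨z, hz, rfl⟩ := hb
  have hprime : (s.restrict P).IsPrime := inferInstance
  have h3 : q * (p - z) ∈ s.restrict P := by
    have : q * (p - z) = g + a := by linear_combination -hab
    rw [this]
    exact add_mem hgP (Ideal.mul_le_right ha)
  have h4 : p - z ∈ s.restrict P := by
    refine (hprime.mem_or_mem h3).resolve_left fun h' => hh ?_
    rw [← hq]
    exact h'
  refine s.mem_special.2 ⟨p - z, h4, ?_⟩
  rw [map_sub, RingHom.mem_ker.1 hz, sub_zero]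

end RingSpecialization

namespace MvPolynomial

/-- The polynomial with prescribed coefficients at a finite set of exponents. -/
noncomputable def ofCoeffs {A ι : Type*} [CommSemiring A] (E : Finset (ι →₀ ℕ)) (w : E → A) :
    MvPolynomial ι A :=
  ∑ t : E, monomial (t : ι →₀ ℕ) (w t)

theorem coeff_ofCoeffs {A ι : Type*} [CommSemiring A] (E : Finset (ι →₀ ℕ)) (w : E → A) (t : E) :
    coeff (t : ι →₀ ℕ) (ofCoeffs E w) = w t := by
  classical
  simp only [ofCoeffs, coeff_sum, coeff_monomial]
  rw [Finset.sum_eq_single t]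
  · rw [if_pos rfl]
  · exact fun b _ hb => if_neg fun h => hb (Subtype.ext h)
  · exact fun h => absurd (Finset.mem_univ t) h

theorem ofCoeffs_coeff {A ι : Type*} [CommSemiring A] (E : Finset (ι →₀ ℕ))
    (g : MvPolynomial ι A) (hg : g.support ⊆ E) :
    ofCoeffs E (fun t => coeff (t : ι →₀ ℕ) g) = g := by
  classical
  rw [ofCoeffs, Finset.sum_coe_sort E (fun t => monomial t (coeff t g))]
  conv_rhs => rw [g.as_sum]
  refine (Finset.sum_subset hg fun d _ hd => ?_).symm
  rw [notMem_support_iff.1 hd, monomial_zero]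

theorem map_ofCoeffs {A B ι : Type*} [CommSemiring A] [CommSemiring B] (ψ : A →+* B)
    (E : Finset (ι →₀ ℕ)) (w : E → A) : map ψ (ofCoeffs E w) = ofCoeffs E (ψ ∘ w) := by
  simp [ofCoeffs, map_sum, map_monomial]

theorem isUnit_iff_coeff {k ι : Type*} [Field k] {g : MvPolynomial ι k} :
    IsUnit g ↔ coeff 0 g ≠ 0 ∧ ∀ d ≠ 0, coeff d g = 0 := by
  simp [isUnit_iff]

/-- The equations expressing that `f` is the product of two polynomials with given supports. -/
noncomputable def factorEq {A ι : Type*} [CommRing A] (E : Finset (ι →₀ ℕ)) (f : MvPolynomial ι A)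
    (k : ι →₀ ℕ) : MvPolynomial (E ⊕ E) A :=
  coeff k (map C f - ofCoeffs E (fun t => X (Sum.inl t)) * ofCoeffs E (fun t => X (Sum.inr t)))

theorem eval₂Hom_factorEq {A B ι : Type*} [CommRing A] [CommRing B] (ψ : A →+* B)
    (E : Finset (ι →₀ ℕ)) (f : MvPolynomial ι A) (k : ι →₀ ℕ) (w : E ⊕ E → B) :
    eval₂Hom ψ w (factorEq E f k) =
      coeff k (map ψ f - ofCoeffs E (w ∘ Sum.inl) * ofCoeffs E (w ∘ Sum.inr)) := by
  rw [factorEq, ← coeff_map, map_sub, map_mul, map_ofCoeffs, map_ofCoeffs, map_map]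
  congr 3
  · congr 1
    ext; simp
  · congr 1; ext; simp
  · congr 1; ext; simp

theorem map_factorEq {A B ι : Type*} [CommRing A] [CommRing B] (ψ : A →+* B)
    (E : Finset (ι →₀ ℕ)) (f : MvPolynomial ι A) (k : ι →₀ ℕ) :
    map ψ (factorEq E f k) = factorEq E (map ψ f) k := by
  rw [factorEq, ← coeff_map, map_sub, map_mul, map_ofCoeffs, map_ofCoeffs, map_map, factorEq,
    map_map]
  congr 3
  · congr 1
    ext; simp
  · congr 1; ext; simp
  · congr 1; ext; simp

theorem X_mul_X_mem_radical_factorEq {L ι : Type*} [Field L] [IsAlgClosed L]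
    (E : Finset (ι →₀ ℕ)) {f : MvPolynomial ι L} (hf : Irreducible f) (t₀ t₁ : E)
    (h₀ : (t₀ : ι →₀ ℕ) ≠ 0) (h₁ : (t₁ : ι →₀ ℕ) ≠ 0) :
    X (Sum.inl t₀) * X (Sum.inr t₁) ∈ (Ideal.span (Set.range (factorEq E f))).radical := by
  rw [← vanishingIdeal_zeroLocus_eq_radical (K := L), mem_vanishingIdeal_iff]
  intro x hx
  have h : f = ofCoeffs E (x ∘ Sum.inl) * ofCoeffs E (x ∘ Sum.inr) := by
    rw [← sub_eq_zero]
    ext k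
    have h1 : eval₂Hom (algebraMap L L) x (factorEq E f k) = 0 :=
      hx _ (Ideal.subset_span ⟨k, rfl⟩)
    rw [eval₂Hom_factorEq, Algebra.algebraMap_self, map_id] at h1
    simpa using h1
  rw [map_mul, aeval_X, aeval_X]
  rcases hf.isUnit_or_isUnit h with h | h
  · have := (isUnit_iff_coeff.1 h).2 _ h₀
    rw [coeff_ofCoeffs] at this
    exact mul_eq_zero_of_left this _
  · have := (isUnit_iff_coeff.1 h).2 _ h₁
    rw [coeff_ofCoeffs] at this
    exact mul_eq_zero_of_right _ this

theorem support_subset_of_mul_eq {k ι : Type*} [Field k] {f g h : MvPolynomial ι k} (hf : f ≠ 0)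
    (hfgh : f = g * h) (E : Finset (ι →₀ ℕ)) (hE : ∀ d, (∀ i, d i ≤ degreeOf i f) → d ∈ E) :
    g.support ⊆ E ∧ h.support ⊆ E := by
  have hg : g ≠ 0 := by rintro rfl; simp [hfgh] at hf
  have hh : h ≠ 0 := by rintro rfl; simp [hfgh] at hf
  constructor <;> intro d hd <;> refine hE d fun i => ?_ <;> rw [hfgh, degreeOf_mul_eq hg hh]
  · exact (monomial_le_degreeOf i hd).trans le_self_add
  · exact (monomial_le_degreeOf i hd).trans le_add_self

end MvPolynomial

namespace RingSpecialization

variable {L K τ : Type*} [Field L] [Field K]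

theorem eventually_irreducible_red [IsAlgClosed L] [Finite τ] {f : MvPolynomial τ L}
    (hf : Irreducible f) :
    ∀ᶠ s : RingSpecialization L K in generic L K, ∀ q, s.incl q = f → Irreducible (s.red q) := by
  classical
  have := Fintype.ofFinite τ
  let E : Finset (τ →₀ ℕ) := Finset.Iic (Finsupp.equivFunOnFinite.symm fun i => degreeOf i f)
  have hE : ∀ d : τ →₀ ℕ, (∀ i, d i ≤ degreeOf i f) → d ∈ E := fun d hd =>
    Finset.mem_Iic.2 fun i => by simpa using hd i
  obtain ⟨d, hd0, hd⟩ : ∃ d ≠ 0, coeff d f ≠ 0 := by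
    by_contra! h
    refine hf.not_isUnit (isUnit_iff_coeff.2 ⟨fun h0 => hf.ne_zero ?_, h⟩)
    ext d
    by_cases hd : d = 0
    · rw [hd, h0, coeff_zero]
    · rw [h d hd, coeff_zero]
  have h1 : ∀ᶠ s in generic L K, ∀ t₀ t₁ : E, (t₀ : τ →₀ ℕ) ≠ 0 → (t₁ : τ →₀ ℕ) ≠ 0 → ∃ N : ℕ,
      (X (Sum.inl t₀) * X (Sum.inr t₁)) ^ N ∈
        Ideal.span (s.incl ⁻¹' (Set.range (factorEq E f))) := by
    refine Filter.eventually_all.2 fun t₀ => Filter.eventually_all.2 fun t₁ => ?_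
    by_cases h₀ : (t₀ : τ →₀ ℕ) = 0
    · simp [h₀]
    by_cases h₁ : (t₁ : τ →₀ ℕ) = 0
    · simp [h₁]
    obtain ⟨N, hN⟩ := X_mul_X_mem_radical_factorEq E hf t₀ t₁ h₀ h₁
    filter_upwards [eventually_mem_span hN] with s hs
    exact fun _ _ => ⟨N, hs _ (by simp)⟩
  filter_upwards [h1, eventually_mem (coeff d f)⁻¹] with s hs hsd q hq
  have hqd : coeff d (s.red q) ≠ 0 := by
    intro h0
    rw [coeff_map] at h0
    have h1 : coeff d q * ⟨_, hsd⟩ = 1 := by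
      apply Subtype.val_injective
      have : ((coeff d q : s.R) : L) = coeff d f := by rw [← hq, coeff_map]; rfl
      push_cast
      rw [this, mul_inv_cancel₀ hd]
    simpa [h0] using congrArg s.φ h1
  have hq0 : s.red q ≠ 0 := fun h => hqd (by rw [h, coeff_zero])
  have hdeg : ∀ i, degreeOf i (s.red q) ≤ degreeOf i f := by
    intro i
    rw [degreeOf_le_iff]
    intro m hm
    refine monomial_le_degreeOf i ?_
    rw [← hq, support_map_of_injective _ Subtype.val_injective]
    exact support_map_subset _ _ hm
  refine ⟨fun h => hqd ((isUnit_iff_coeff.1 h).2 d hd0), fun g h hgh => ?_⟩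
  by_contra! hn
  obtain ⟨hgE, hhE⟩ := support_subset_of_mul_eq hq0 hgh E
    fun d hd => hE d fun i => (hd i).trans (hdeg i)
  have key : ∀ p : MvPolynomial τ K, p ≠ 0 → ¬ IsUnit p → p.support ⊆ E →
      ∃ t : E, (t : τ →₀ ℕ) ≠ 0 ∧ coeff (t : τ →₀ ℕ) p ≠ 0 := by
    intro p hp0 hpu hpE
    by_contra! H
    have H' : ∀ d ≠ 0, coeff d p = 0 := by
      intro d hd
      by_contra hc
      exact hc (H ⟨d, hpE (mem_support_iff.2 hc)⟩ hd)
    refine hpu (isUnit_iff_coeff.2 ⟨fun h0 => hp0 ?_, H'⟩)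
    ext d
    by_cases hd : d = 0
    · rw [hd, h0, coeff_zero]
    · rw [H' d hd, coeff_zero]
  obtain ⟨t₀, h₀, hg⟩ := key g (by rintro rfl; simp [hgh] at hq0) hn.1 hgE
  obtain ⟨t₁, h₁, hh⟩ := key h (by rintro rfl; simp [hgh] at hq0) hn.2 hhE
  obtain ⟨N, hN⟩ := hs t₀ t₁ h₀ h₁
  let w : E ⊕ E → K := Sum.elim (fun t => coeff (t : τ →₀ ℕ) g) (fun t => coeff (t : τ →₀ ℕ) h)
  have hle : Ideal.span (s.incl ⁻¹' (Set.range (factorEq E f))) ≤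
      RingHom.ker (eval₂Hom s.φ w) := by
    refine Ideal.span_le.2 ?_
    rintro p ⟨k, hk⟩
    have : p = factorEq E q k := s.incl_injective (by rw [← hk, map_factorEq, hq])
    rw [SetLike.mem_coe, RingHom.mem_ker, this, eval₂Hom_factorEq, Sum.elim_comp_inl,
      Sum.elim_comp_inr, ofCoeffs_coeff E g hgE, ofCoeffs_coeff E h hhE]
    change coeff k (s.red q - _) = 0
    rw [hgh, sub_self, coeff_zero]
  have := hle hN
  rw [RingHom.mem_ker, map_pow, map_mul, coe_eval₂Hom, eval₂_X, eval₂_X] at this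
  exact mul_ne_zero hg hh (eq_zero_of_pow_eq_zero this)

theorem eventually_isPrime_special_span_singleton [IsAlgClosed L] [Finite τ]
    {f : MvPolynomial τ L} (hf : Irreducible f) :
    ∀ᶠ s : RingSpecialization L K in generic L K, (s.special (Ideal.span {f})).IsPrime := by
  filter_upwards [eventually_irreducible_red hf, eventually_special_span_le {f}, eventually_lift f]
    with s h1 h2 ⟨q, hq⟩
  have : s.special (Ideal.span {f}) = Ideal.span {s.red q} := by
    refine le_antisymm (h2.trans (Ideal.span_le.2 ?_)) (Ideal.span_le.2 ?_)
    · rintro _ ⟨p, hp, rfl⟩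
      rw [s.incl_injective (hq.trans hp.symm)]
      exact Ideal.subset_span rfl
    · rintro _ rfl
      exact s.mem_special.2 ⟨q, by rw [hq]; exact Ideal.subset_span rfl, rfl⟩
  rw [this, Ideal.span_singleton_prime (h1 q hq).ne_zero]
  exact (h1 q hq).prime

end RingSpecialization

/-- A finite family in a field generated by `v` has a common denominator. -/
theorem exists_common_denominator {L M ι τ : Type*} [Field L] [Field M] [Algebra L M] [Finite τ]
    (v : ι → M) (hv : IntermediateField.adjoin L (Set.range v) = ⊤) (u : τ → M) :
    ∃ h : MvPolynomial ι L, aeval v h ≠ 0 ∧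
      ∀ i, ∃ r : MvPolynomial ι L, aeval v h * u i = aeval v r := by
  classical
  have := Fintype.ofFinite τ
  have key : ∀ i, ∃ h : MvPolynomial ι L, aeval v h ≠ 0 ∧ ∃ r : MvPolynomial ι L, aeval v h * u i = aeval v r := by
    intro i
    have hi : u i ∈ IntermediateField.adjoin L (Set.range v) := hv ▸ IntermediateField.mem_top
    obtain ⟨r, h, hrh⟩ := (IntermediateField.mem_adjoin_range_iff _ _ _).1 hi
    by_cases h0 : aeval v h = 0
    · exact ⟨1, by simp, 0, by simp [hrh, h0]⟩
    · exact ⟨h, h0, r, by rw [hrh, mul_div_cancel₀ _ h0]⟩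
  choose h hh r hr using key
  refine ⟨∏ i, h i, ?_, fun i => ⟨(∏ j ∈ Finset.univ.erase i, h j) * r i, ?_⟩⟩
  · rw [map_prod]
    exact Finset.prod_ne_zero_iff.2 fun i _ => hh i
  · rw [← Finset.prod_erase_mul _ _ (Finset.mem_univ i), map_mul, mul_assoc, hr, map_mul]

namespace RingSpecialization

variable {L K M τ ι : Type*} [Field L] [Field K] [Field M] [Algebra L M]

/-- Evaluation of polynomials over the domain of `s` at a family in a field extension. -/
noncomputable abbrev ev (s : RingSpecialization L K) (u : τ → M) : MvPolynomial τ s.R →+* M :=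
  (aeval u : MvPolynomial τ L →ₐ[L] M).toRingHom.comp s.incl

theorem ev_apply (s : RingSpecialization L K) (u : τ → M) (p : MvPolynomial τ s.R) :
    s.ev u p = aeval u (s.incl p) := rfl

/-- `z` is the value at `u` of a polynomial over the domain of `s` with zero reduction. -/
def Small (s : RingSpecialization L K) (u : τ → M) (z : M) : Prop :=
  ∃ e, s.red e = 0 ∧ s.ev u e = z

theorem small_ev_iff (s : RingSpecialization L K) (u : τ → M) (p : MvPolynomial τ s.R) :
    s.Small u (s.ev u p) ↔ s.red p ∈ s.special (RingHom.ker (aeval (R := L) u)) := by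
  rw [mem_special]
  constructor
  · rintro ⟨e, he, hep⟩
    refine ⟨p - e, ?_, by rw [map_sub, he, sub_zero]⟩
    rw [RingHom.mem_ker, ← ev_apply, map_sub, hep, sub_self]
  · rintro ⟨q, hq, hqp⟩
    refine ⟨p - q, by rw [map_sub, hqp, sub_self], ?_⟩
    rw [map_sub, ev_apply s u q, RingHom.mem_ker.1 hq, sub_zero]

theorem Small.add {s : RingSpecialization L K} {u : τ → M} {y z : M} (hy : s.Small u y)
    (hz : s.Small u z) : s.Small u (y + z) := by
  obtain ⟨e, he, rfl⟩ := hy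
  obtain ⟨f, hf, rfl⟩ := hz
  exact ⟨e + f, by rw [map_add, he, hf, add_zero], map_add _ _ _⟩

theorem Small.mul_left {s : RingSpecialization L K} {u : τ → M} {y z : M}
    (hy : y ∈ (s.ev u).range) (hz : s.Small u z) : s.Small u (y * z) := by
  obtain ⟨p, rfl⟩ := hy
  obtain ⟨f, hf, rfl⟩ := hz
  exact ⟨p * f, by rw [map_mul, hf, mul_zero], map_mul _ _ _⟩

theorem Small.mem_range {s : RingSpecialization L K} {u : τ → M} {z : M} (hz : s.Small u z) :
    z ∈ (s.ev u).range :=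
  hz.imp fun _ h => h.2

theorem algebraMap_mem_range_ev (s : RingSpecialization L K) (u : τ → M) (c : s.R) :
    algebraMap L M c ∈ (s.ev u).range :=
  ⟨C c, by simp [ev_apply]⟩

theorem exists_pow_mul_mem_range (s : RingSpecialization L K) {u : τ → M} {v : ι → M} {H : M}
    (hH : H ∈ (s.ev u).range) (h : ∀ j, H * v j ∈ (s.ev u).range) {z : M}
    (hz : z ∈ (s.ev v).range) : ∃ N : ℕ, H ^ N * z ∈ (s.ev u).range := by
  obtain ⟨p, rfl⟩ := hz
  induction p using MvPolynomial.induction_on with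
  | C c => exact ⟨0, by simpa [ev_apply] using s.algebraMap_mem_range_ev u c⟩
  | add p q hp hq =>
    obtain ⟨N, hN⟩ := hp
    obtain ⟨N', hN'⟩ := hq
    refine ⟨N + N', ?_⟩
    have : H ^ (N + N') * s.ev v (p + q) =
        H ^ N' * (H ^ N * s.ev v p) + H ^ N * (H ^ N' * s.ev v q) := by
      rw [map_add]; ring
    rw [this]
    exact add_mem (mul_mem (pow_mem hH _) hN) (mul_mem (pow_mem hH _) hN')
  | mul_X p j hp =>
    obtain ⟨N, hN⟩ := hp
    refine ⟨N + 1, ?_⟩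
    have : H ^ (N + 1) * s.ev v (p * X j) = (H ^ N * s.ev v p) * (H * v j) := by
      rw [map_mul, ev_apply s v (X j), map_X, aeval_X]; ring
    rw [this]
    exact mul_mem hN (h j)

theorem exists_pow_mul_small (s : RingSpecialization L K) {u : τ → M} {v : ι → M} {H : M}
    (hH : H ∈ (s.ev u).range) (h : ∀ j, H * v j ∈ (s.ev u).range) {z : M}
    (hz : s.Small v z) : ∃ N : ℕ, s.Small u (H ^ N * z) := by
  obtain ⟨e, he, rfl⟩ := hz
  replace he : e ∈ Ideal.map C (RingHom.ker s.φ) := by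
    rwa [← MvPolynomial.ker_map, RingHom.mem_ker]
  induction he using Submodule.span_induction with
  | mem x hx =>
    obtain ⟨c, hc, rfl⟩ := hx
    refine ⟨0, C c, by rw [map_C, RingHom.mem_ker.1 hc, C_0], ?_⟩
    simp [ev_apply]
  | zero => exact ⟨0, 0, by simp, by simp⟩
  | add p q _ _ hp hq =>
    obtain ⟨N, hN⟩ := hp
    obtain ⟨N', hN'⟩ := hq
    refine ⟨N + N', ?_⟩
    have : H ^ (N + N') * s.ev v (p + q) =
        H ^ N' * (H ^ N * s.ev v p) + H ^ N * (H ^ N' * s.ev v q) := by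
      rw [map_add]; ring
    rw [this]
    exact (hN.mul_left (pow_mem hH _)).add (hN'.mul_left (pow_mem hH _))
  | smul a p _ hp =>
    obtain ⟨N, hN⟩ := hp
    obtain ⟨N', hN'⟩ := s.exists_pow_mul_mem_range hH h (z := s.ev v a) ⟨a, rfl⟩
    refine ⟨N' + N, ?_⟩
    have : H ^ (N' + N) * s.ev v (a • p) = (H ^ N' * s.ev v a) * (H ^ N * s.ev v p) := by
      rw [smul_eq_mul, map_mul]; ring
    rw [this]
    exact hN.mul_left hN'

theorem eventually_small_of_pow_mul [Finite τ] (u : τ → M) {h : MvPolynomial τ L}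
    (hh : aeval u h ≠ 0) :
    ∀ᶠ s : RingSpecialization L K in generic L K, aeval u h ∈ (s.ev u).range ∧
      ∀ (k : ℕ) (z : M), z ∈ (s.ev u).range → s.Small u ((aeval u h) ^ k * z) → s.Small u z := by
  have : (RingHom.ker (aeval (R := L) u)).IsPrime := RingHom.ker_isPrime _
  filter_upwards [eventually_mem_special_of_mul_mem (P := RingHom.ker (aeval (R := L) u)) hh,
    eventually_lift h] with s hs ⟨q, hq⟩
  have hr : aeval u h ∈ (s.ev u).range := ⟨q, by rw [ev_apply, hq]⟩
  refine ⟨hr, fun k => ?_⟩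
  induction k with
  | zero => simp
  | succ k ih =>
    intro z hz hsm
    rw [pow_succ, mul_assoc] at hsm
    have := ih _ (mul_mem hr hz) hsm
    obtain ⟨p, rfl⟩ := hz
    rw [← hq, ← ev_apply, ← map_mul, small_ev_iff, map_mul] at this
    exact (small_ev_iff _ _ _).2 (hs q hq _ this)

/-- Generic primality of the specialization of the ideal of relations between generators of a
field extension does not depend on the generators. -/
theorem eventually_isPrime_special_ker_aeval [IsAlgClosed L] [Finite τ] [Finite ι]
    (u : τ → M) (v : ι → M) (hu : IntermediateField.adjoin L (Set.range u) = ⊤)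
    (hv : IntermediateField.adjoin L (Set.range v) = ⊤)
    (hprime : ∀ᶠ s : RingSpecialization L K in generic L K,
      (s.special (RingHom.ker (aeval (R := L) v))).IsPrime) :
    ∀ᶠ s : RingSpecialization L K in generic L K,
      (s.special (RingHom.ker (aeval (R := L) u))).IsPrime := by
  obtain ⟨h, hh0, hh⟩ := exists_common_denominator v hv u
  obtain ⟨H, hH0, hH⟩ := exists_common_denominator u hu v
  choose r hr using hh
  choose ψ hψ using hH
  obtain ⟨b, hb0, hab⟩ := exists_common_denominator u hu (fun _ : Unit => aeval v h)
  obtain ⟨a, hab⟩ := hab ()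
  have ha0 : aeval u a ≠ 0 := hab ▸ mul_ne_zero hb0 hh0
  have : (RingHom.ker (aeval (R := L) u)).IsPrime := RingHom.ker_isPrime _
  have h1 : (1 : MvPolynomial τ L) ∉ (RingHom.ker (aeval (R := L) u)).radical := by
    rw [this.radical, RingHom.mem_ker, map_one]
    exact one_ne_zero
  have hr' : ∀ᶠ s : RingSpecialization L K in generic L K, ∀ i, ∃ q, s.incl q = r i :=
    Filter.eventually_all.2 fun i => eventually_lift _
  have hψ' : ∀ᶠ s : RingSpecialization L K in generic L K, ∀ i, ∃ q, s.incl q = ψ i :=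
    Filter.eventually_all.2 fun i => eventually_lift _
  filter_upwards [hprime, eventually_small_of_pow_mul u ha0, eventually_small_of_pow_mul u hH0,
    eventually_red_notMem_special h1, eventually_lift h, eventually_lift b, hr', hψ']
    with s hp hsa hsH hs1 ⟨h', hh'⟩ ⟨b', hb'⟩ hr' hψ'
  have hhr : aeval v h ∈ (s.ev v).range := ⟨h', by rw [ev_apply, hh']⟩
  have hbr : aeval u b ∈ (s.ev u).range := ⟨b', by rw [ev_apply, hb']⟩
  have hvr : ∀ i, aeval v h * u i ∈ (s.ev v).range := fun i => by
    obtain ⟨q, hq⟩ := hr' i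
    exact ⟨q, by rw [ev_apply, hq, hr]⟩
  have hur : ∀ i, aeval u H * v i ∈ (s.ev u).range := fun i => by
    obtain ⟨q, hq⟩ := hψ' i
    exact ⟨q, by rw [ev_apply, hq, hψ]⟩
  have back : ∀ (z : M) (N : ℕ), z ∈ (s.ev u).range → s.Small v (aeval v h ^ N * z) →
      s.Small u z := by
    intro z N hz hsm
    obtain ⟨N', hN'⟩ := s.exists_pow_mul_small hsH.1 hur hsm
    refine hsa.2 N z hz (hsH.2 N' _ (mul_mem (pow_mem hsa.1 _) hz) ?_)
    have : aeval u H ^ N' * (aeval u a ^ N * z) =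
        aeval u b ^ N * (aeval u H ^ N' * (aeval v h ^ N * z)) := by
      rw [← hab]; ring
    rw [this]
    exact hN'.mul_left (pow_mem hbr _)
  refine ⟨(Ideal.ne_top_iff_one _).2 ?_, fun {p p'} hpp => ?_⟩
  · simpa using hs1 1 (map_one _)
  obtain ⟨p, rfl⟩ := s.red_surjective p
  obtain ⟨p', rfl⟩ := s.red_surjective p'
  rw [← map_mul, ← small_ev_iff, map_mul] at hpp
  rw [← small_ev_iff, ← small_ev_iff]
  obtain ⟨N₁, g, hg⟩ := s.exists_pow_mul_mem_range hhr hvr (z := s.ev u p) ⟨p, rfl⟩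
  obtain ⟨N₂, g', hg'⟩ := s.exists_pow_mul_mem_range hhr hvr (z := s.ev u p') ⟨p', rfl⟩
  obtain ⟨N₃, hN₃⟩ := s.exists_pow_mul_small hhr hvr hpp
  have hsm : s.Small v (s.ev v (h' ^ N₃ * g * g')) := by
    have : s.ev v (h' ^ N₃ * g * g') = aeval v h ^ (N₁ + N₂) *
        (aeval v h ^ N₃ * (s.ev u p * s.ev u p')) := by
      rw [map_mul, map_mul, hg, hg', map_pow, ev_apply s v h', hh']
      ring
    rw [this]
    exact hN₃.mul_left (pow_mem hhr _)
  rw [small_ev_iff, map_mul] at hsm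
  rcases hp.mem_or_mem hsm with hm | hm
  · left
    rw [← small_ev_iff, map_mul, hg, map_pow, ev_apply s v h', hh', ← mul_assoc, ← pow_add] at hm
    exact back _ _ ⟨p, rfl⟩ hm
  · right
    rw [← small_ev_iff, hg'] at hm
    exact back _ _ ⟨p', rfl⟩ hm

end RingSpecialization

namespace Polynomial

/-- A nonzero prime ideal of `A[X]` lying over zero, for `A` a UFD, is generated by an irreducible
polynomial. -/
theorem exists_irreducible_eq_span {A : Type*} [CommRing A] [IsDomain A]
    [UniqueFactorizationMonoid A] (Q : Ideal (Polynomial A)) [hQp : Q.IsPrime] (hQ : Q ≠ ⊥)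
    (h0 : ∀ c, C c ∈ Q → c = 0) : ∃ f, Irreducible f ∧ Q = Ideal.span {f} := by
  classical
  have hex : ∃ n, ∃ f ∈ Q, f ≠ 0 ∧ f.natDegree = n := by
    obtain ⟨f, hf, hf0⟩ := Submodule.exists_mem_ne_zero_of_ne_bot hQ
    exact ⟨_, f, hf, hf0, rfl⟩
  obtain ⟨f₀, hf₀, hf₀0, hn⟩ := Nat.find_spec hex
  have hmin : ∀ g ∈ Q, g ≠ 0 → f₀.natDegree ≤ g.natDegree := fun g hg hg0 =>
    hn ▸ Nat.find_min' hex ⟨g, hg, hg0, rfl⟩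
  obtain ⟨l, hl, hlf⟩ := UniqueFactorizationMonoid.exists_prime_factors f₀ hf₀0
  have hlQ : l.prod ∈ Q := by
    obtain ⟨u, hu⟩ := hlf.symm
    rw [← hu]
    exact Q.mul_mem_right _ hf₀
  obtain ⟨f, hfl, hfQ⟩ := (hQp.multiset_prod_mem_iff_exists_mem l).1 hlQ
  have hf := hl f hfl
  have hff₀ : f ∣ f₀ := (Multiset.dvd_prod hfl).trans hlf.dvd
  have hmin' : ∀ g ∈ Q, g ≠ 0 → f.natDegree ≤ g.natDegree := fun g hg hg0 =>
    (natDegree_le_of_dvd hff₀ hf₀0).trans (hmin g hg hg0)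
  have hlc : C f.leadingCoeff ∉ Q := fun h => hf.ne_zero (leadingCoeff_eq_zero.1 (h0 _ h))
  have hpos : ∀ g ∈ Q, g ≠ 0 → 0 < g.natDegree := by
    intro g hg hg0
    by_contra! h
    rw [Nat.le_zero, natDegree_eq_zero] at h
    obtain ⟨c, rfl⟩ := h
    exact hg0 (by rw [h0 c hg, C_0])
  have hdiv : ∀ n, ∀ g ∈ Q, g.natDegree ≤ n → f ∣ g := by
    intro n
    induction n with
    | zero =>
      intro g hg hgn
      have : g = 0 := by
        by_contra hg0
        have := hpos g hg hg0
        omega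
      exact this ▸ dvd_zero f
    | succ n ih =>
      intro g hg hgn
      by_cases hg0 : g = 0
      · exact hg0 ▸ dvd_zero f
      have hle := hmin' g hg hg0
      have hlt := natDegree_cancelLeads_lt_of_natDegree_le_natDegree hle (hpos g hg hg0)
      have hmem : f.cancelLeads g ∈ Q :=
        sub_mem (Q.mul_mem_left _ hg) (Q.mul_mem_left _ hfQ)
      have h := ih _ hmem (by omega)
      rw [cancelLeads, tsub_eq_zero_iff_le.2 hle, pow_zero, mul_one] at h
      have h2 : f ∣ C f.leadingCoeff * g := (dvd_sub_left (dvd_mul_left f _)).1 h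
      exact (hf.dvd_or_dvd h2).resolve_left fun h3 => hlc (Q.mem_of_dvd h3 hfQ)
  refine ⟨f, hf.irreducible, le_antisymm (fun g hg => ?_) ?_⟩
  · exact Ideal.mem_span_singleton.2 (hdiv _ g hg le_rfl)
  · rwa [Ideal.span_singleton_le_iff_mem]

end Polynomial

/-- The ideal of relations of a transcendence basis together with one further element is generated
by an irreducible polynomial. -/
theorem IsTranscendenceBasis.exists_irreducible_ker_aeval {L M ι : Type*} [Field L] [Field M]
    [Algebra L M] {x : ι → M} (hx : IsTranscendenceBasis L x) (θ : M) :
    ∃ f, Irreducible f ∧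
      RingHom.ker (aeval (R := L) (fun o : Option ι => o.elim θ x)) = Ideal.span {f} := by
  let v : Option ι → M := fun o => o.elim θ x
  let e := (optionEquivLeft L ι).symm
  have hQp : (RingHom.ker (aeval (R := L) v)).IsPrime := RingHom.ker_isPrime _
  let Q : Ideal (Polynomial (MvPolynomial ι L)) := (RingHom.ker (aeval (R := L) v)).comap e
  have hC : ∀ c, aeval v (e (Polynomial.C c)) = aeval x c := by
    intro c
    have : ((aeval v).comp (e.toAlgHom.comp (Algebra.algHom L _ _) :
        MvPolynomial ι L →ₐ[L] _)) = aeval x := by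
      ext i
      change aeval v (e (Polynomial.C (X i))) = _
      rw [optionEquivLeft_symm_C_X, aeval_X, aeval_X]
      rfl
    exact DFunLike.congr_fun this c
  have hQ0 : Q ≠ ⊥ := by
    intro h
    have hind : ¬ AlgebraicIndependent L v := by
      rw [hx.1.option_iff_transcendental]
      have := hx.isAlgebraic
      exact fun h => h (Algebra.IsAlgebraic.isAlgebraic θ)
    refine hind ((injective_iff_map_eq_zero (aeval (R := L) v)).2 fun p hp => ?_)
    have : e.symm p ∈ Q := by
      rw [Ideal.mem_comap, AlgEquiv.apply_symm_apply]
      exact hp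
    rw [h, Ideal.mem_bot] at this
    simpa using this
  obtain ⟨f, hf, hQ⟩ := Polynomial.exists_irreducible_eq_span Q hQ0 (fun c hc => by
    rw [Ideal.mem_comap, RingHom.mem_ker, hC] at hc
    exact (injective_iff_map_eq_zero (aeval (R := L) x)).1 hx.1 c hc)
  refine ⟨e f, (MulEquiv.irreducible_iff e).2 hf, ?_⟩
  ext p
  rw [Ideal.mem_span_singleton]
  have h1 : p ∈ RingHom.ker (aeval (R := L) v) ↔ e.symm p ∈ Q := by
    rw [Ideal.mem_comap, AlgEquiv.apply_symm_apply]
  rw [h1, hQ, Ideal.mem_span_singleton, ← map_dvd_iff e, AlgEquiv.apply_symm_apply]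

theorem exists_adjoin_eq_top_and_ker_eq_span {L M : Type*} [Field L] [Field M]
    [Algebra L M] [PerfectField L] [Algebra.EssFiniteType L M] :
    ∃ (s : Finset M) (v : Option s → M) (f : _),
      IntermediateField.adjoin L (Set.range v) = ⊤ ∧ Irreducible f ∧
      RingHom.ker (aeval (R := L) v) = Ideal.span {f} := by
  classical
  obtain ⟨s, hs, hsep⟩ := exists_isTranscendenceBasis_and_isSeparable_of_perfectField L M
  let F := IntermediateField.adjoin L (s : Set M)
  have : Algebra.IsSeparable F M := hsep
  have : Algebra.EssFiniteType F M := .of_comp L F M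
  have : FiniteDimensional F M := by
    obtain ⟨t, ht⟩ := IntermediateField.fg_top F M
    have := IntermediateField.finiteDimensional_adjoin (K := F) (S := (t : Set M))
      (fun x _ => Algebra.IsIntegral.isIntegral x)
    rw [ht] at this
    exact Module.Finite.equiv (IntermediateField.topEquiv (F := F) (E := M)).toLinearEquiv
  obtain ⟨θ, hθ⟩ := Field.exists_primitive_element F M
  obtain ⟨f, hf, hker⟩ := hs.exists_irreducible_ker_aeval θ
  refine ⟨s, _, f, ?_, hf, hker⟩
  have h1 := IntermediateField.adjoin_adjoin_left L (s : Set M) {θ}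
  rw [hθ, IntermediateField.restrictScalars_top] at h1
  rw [h1]
  congr 1
  ext z
  simp only [Set.mem_range, Option.exists, Option.elim, Set.mem_union, Set.mem_singleton_iff,
    Finset.mem_coe]
  aesop

namespace RingSpecialization

variable {L K τ : Type*} [Field L] [Field K]

/-- Prime ideals over an algebraically closed field specialize generically to prime ideals. -/
theorem eventually_isPrime_special [IsAlgClosed L] [Finite τ] (P : Ideal (MvPolynomial τ L))
    [P.IsPrime] : ∀ᶠ s : RingSpecialization L K in generic L K, (s.special P).IsPrime := by
  let M := FractionRing (MvPolynomial τ L ⧸ P)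
  let u : τ → M := fun i => algebraMap _ M (Ideal.Quotient.mk P (X i))
  have hu : (aeval u : MvPolynomial τ L →ₐ[L] M) =
      (IsScalarTower.toAlgHom L (MvPolynomial τ L ⧸ P) M).comp (Ideal.Quotient.mkₐ L P) := by
    ext i
    simp [u]
  have hker : RingHom.ker (aeval (R := L) u) = P := by
    ext p
    rw [RingHom.mem_ker, hu]
    change algebraMap _ M (Ideal.Quotient.mk P p) = 0 ↔ _
    rw [FaithfulSMul.algebraMap_eq_zero_iff, Ideal.Quotient.eq_zero_iff_mem]
  have htop : IntermediateField.adjoin L (Set.range u) = ⊤ := by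
    refine eq_top_iff.2 fun z _ => ?_
    obtain ⟨a, b, -, rfl⟩ := IsFractionRing.div_surjective (MvPolynomial τ L ⧸ P) z
    obtain ⟨a, rfl⟩ := Ideal.Quotient.mk_surjective a
    obtain ⟨b, rfl⟩ := Ideal.Quotient.mk_surjective b
    rw [IntermediateField.mem_adjoin_range_iff]
    exact ⟨a, b, by rw [hu]; rfl⟩
  have : Algebra.EssFiniteType L M := inferInstance
  obtain ⟨s, v, f, hv, hf, hvf⟩ := exists_adjoin_eq_top_and_ker_eq_span (L := L) (M := M)
  have := eventually_isPrime_special_ker_aeval (K := K) u v htop hv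
    (by rw [hvf]; exact eventually_isPrime_special_span_singleton hf)
  rwa [hker] at this

end RingSpecialization

/-- A surjection to an algebraically closed field extends along integral extensions. -/
theorem RingHom.exists_comp_algebraMap_eq_of_isIntegral {A B K : Type*} [CommRing A] [CommRing B]
    [Algebra A B] [Algebra.IsIntegral A B] [FaithfulSMul A B] [Field K] [IsAlgClosed K]
    (ψ : A →+* K) (hψ : Function.Surjective ψ) : ∃ φ : B →+* K, φ.comp (algebraMap A B) = ψ := by
  have hmax : (RingHom.ker ψ).IsMaximal := RingHom.ker_isMaximal_of_surjective ψ hψ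
  obtain ⟨Q, hQ, hQψ⟩ := Ideal.exists_ideal_over_maximal_of_isIntegral (S := B) (RingHom.ker ψ)
    (by rw [(RingHom.injective_iff_ker_eq_bot _).1 (FaithfulSMul.algebraMap_injective A B)]
        exact bot_le)
  let f : A →+* B ⧸ Q := (Ideal.Quotient.mk Q).comp (algebraMap A B)
  have hf : RingHom.ker ψ ≤ RingHom.ker f := by
    rw [← hQψ]
    intro a ha
    rw [RingHom.mem_ker]
    exact Ideal.Quotient.eq_zero_iff_mem.2 ha
  let g : K →+* B ⧸ Q := ψ.liftOfSurjective hψ ⟨f, hf⟩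
  have hg : g.comp ψ = f := RingHom.liftOfRightInverse_comp ψ _ _ ⟨f, hf⟩
  have hint : g.IsIntegral := by
    refine RingHom.IsIntegral.tower_top ψ g ?_
    rw [hg]
    exact RingHom.IsIntegral.trans _ _ (algebraMap_isIntegral_iff.2 inferInstance)
      (RingHom.isIntegral_of_surjective _ Ideal.Quotient.mk_surjective)
  let e := RingEquiv.ofBijective g (IsAlgClosed.ringHom_bijective_of_isIntegral g hint)
  refine ⟨(e.symm : B ⧸ Q →+* K).comp (Ideal.Quotient.mk Q), ?_⟩
  ext a
  change e.symm (f a) = ψ a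
  rw [← hg]
  exact e.symm_apply_apply _

namespace RingSpecialization

variable {L K : Type*} [Field L] [Field K]

/-- A surjection to a field from a subring of `L` gives a specialization on its localization. -/
theorem exists_of_ringHom {O : Type*} [CommRing O] [Algebra O L] [FaithfulSMul O L]
    (φ : O →+* K) (hφ : Function.Surjective φ) :
    ∃ s : RingSpecialization L K, (∀ o, ∃ h : algebraMap O L o ∈ s.R, s.φ ⟨_, h⟩ = φ o) ∧
      ∀ o, φ o ≠ 0 → (algebraMap O L o)⁻¹ ∈ s.R := by
  have hinj := FaithfulSMul.algebraMap_injective O L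
  have : IsDomain O := hinj.isDomain _
  have hprime : (RingHom.ker φ).IsPrime := RingHom.ker_isPrime φ
  let S := (RingHom.ker φ).primeCompl
  have hS : ∀ y : S, IsUnit (algebraMap O L y) := fun y =>
    ((map_ne_zero_iff _ hinj).2 fun h => y.2 (by rw [h]; exact zero_mem _)).isUnit
  have hS' : ∀ y : S, IsUnit (φ y) := fun y => IsUnit.mk0 _ y.2
  let j : Localization S →+* L := IsLocalization.lift hS
  have hj : Function.Injective j := by
    rw [IsLocalization.lift_injective_iff]
    intro x y
    rw [(IsLocalization.injective (Localization S)
      (Ideal.primeCompl_le_nonZeroDivisors (RingHom.ker φ))).eq_iff, hinj.eq_iff]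
  let e : Localization S ≃+* j.range :=
    RingEquiv.ofBijective j.rangeRestrict ⟨fun x y h => hj (congrArg Subtype.val h),
      j.rangeRestrict_surjective⟩
  let φ' : Localization S →+* K := IsLocalization.lift hS'
  have hjo : ∀ o, j (algebraMap O _ o) = algebraMap O L o := IsLocalization.lift_eq hS
  have heo : ∀ o (h : algebraMap O L o ∈ j.range),
      (φ'.comp (e.symm : j.range →+* Localization S)) ⟨_, h⟩ = φ o := by
    intro o h
    have : (⟨_, h⟩ : j.range) = e (algebraMap O _ o) := Subtype.ext (hjo o).symm
    rw [this, RingHom.comp_apply, RingHom.coe_coe, e.symm_apply_apply]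
    exact IsLocalization.lift_eq hS' o
  refine ⟨⟨j.range, φ'.comp (e.symm : j.range →+* Localization S), fun k => ?_⟩, ?_, ?_⟩
  · obtain ⟨o, rfl⟩ := hφ k
    exact ⟨_, heo o ⟨_, hjo o⟩⟩
  · exact fun o => ⟨⟨_, hjo o⟩, heo o _⟩
  · intro o ho
    let o' : S := ⟨o, ho⟩
    refine ⟨IsLocalization.mk' _ 1 o', ?_⟩
    refine eq_inv_of_mul_eq_one_left ?_
    rw [← hjo, ← map_mul]
    change j (_ * algebraMap O _ (o' : O)) = 1
    rw [IsLocalization.mk'_spec, map_one, map_one]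

/-- Sufficiently generic points lift to generic specializations. -/
theorem exists_of_eventually [IsAlgClosed K] {A : Type*} [CommRing A] [IsDomain A] [Algebra A L]
    [FaithfulSMul A L] [Algebra.IsAlgebraic A L] {P : RingSpecialization L K → Prop}
    (hP : ∀ᶠ s in generic L K, P s) :
    ∃ t : A, t ≠ 0 ∧ ∀ ψ : A →+* K, Function.Surjective ψ → ψ t ≠ 0 →
      ∃ s, P s ∧ ∀ a, ∃ h : algebraMap A L a ∈ s.R, s.φ ⟨_, h⟩ = ψ a := by
  obtain ⟨F, hF⟩ := eventually_generic_iff.1 hP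
  obtain ⟨t, ht, htF⟩ := Algebra.IsAlgebraic.exists_integral_multiples A F
  refine ⟨t, ht, fun ψ hψ hψt => ?_⟩
  let O := integralClosure A L
  obtain ⟨φ, hφ⟩ := RingHom.exists_comp_algebraMap_eq_of_isIntegral (B := O) ψ hψ
  have hφs : Function.Surjective φ := fun k => by
    obtain ⟨a, rfl⟩ := hψ k
    exact ⟨algebraMap A O a, congrArg (fun f => f a) hφ⟩
  have hφa : ∀ a, φ (algebraMap A O a) = ψ a := fun a => congrArg (fun f => f a) hφ
  obtain ⟨s, hs, hs'⟩ := exists_of_ringHom (L := L) φ hφs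
  refine ⟨s, hF s fun c hc => ?_, fun a => ?_⟩
  · have h1 : t • c ∈ s.R := (hs ⟨_, htF c hc⟩).1
    have h2 : (algebraMap A L t)⁻¹ ∈ s.R := hs' (algebraMap A O t) (by rwa [hφa])
    have h3 : c = (algebraMap A L t)⁻¹ * (t • c) := by
      rw [Algebra.smul_def, inv_mul_cancel_left₀]
      exact (map_ne_zero_iff _ (FaithfulSMul.algebraMap_injective A L)).2 ht
    rw [h3]
    exact mul_mem h2 h1
  · obtain ⟨h, hh⟩ := hs (algebraMap A O a)
    exact ⟨h, hh.trans (hφa a)⟩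

end RingSpecialization

section ZariskiTopology

variable {K σ : Type*} [Field K]

theorem MvPolynomial.zeroLocus_mul (I J : Ideal (MvPolynomial σ K)) :
    zeroLocus K (I * J) = zeroLocus K I ∪ zeroLocus K J := by
  refine Set.Subset.antisymm (fun x hx => ?_) (Set.union_subset
    (zeroLocus_anti_mono Ideal.mul_le_left) (zeroLocus_anti_mono Ideal.mul_le_right))
  by_contra! h
  simp only [Set.mem_union, mem_zeroLocus_iff, not_or] at h
  push Not at h
  obtain ⟨⟨p, hp, hpx⟩, q, hq, hqx⟩ := h
  refine mul_ne_zero hpx hqx ?_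
  rw [← map_mul]
  exact hx _ (Ideal.mul_mem_mul hp hq)

theorem MvPolynomial.mem_zeroLocus_iff_eval {I : Ideal (MvPolynomial σ K)} {x : σ → K} :
    x ∈ zeroLocus K I ↔ ∀ p ∈ I, eval x p = 0 := Iff.rfl

theorem MvPolynomial.mem_zeroLocus_span_singleton {p : MvPolynomial σ K} {x : σ → K} :
    x ∈ zeroLocus K (Ideal.span {p}) ↔ eval x p = 0 := by
  rw [zeroLocus_span]
  simp [aeval_eq_eval]

theorem MvPolynomial.zeroLocus_sup (I J : Ideal (MvPolynomial σ K)) :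
    zeroLocus K (I ⊔ J) = zeroLocus K I ∩ zeroLocus K J :=
  (zeroLocus_vanishingIdeal_galoisConnection (k := K) (K := K) (σ := σ)).l_sup

theorem isClosed_zariskiTopology_iff {C : Set (σ → K)} :
    @IsClosed _ (zariskiTopology K σ) C ↔ ∃ I : Ideal (MvPolynomial σ K), C = zeroLocus K I := by
  let := zariskiTopology K σ
  constructor
  · intro h
    have : ∀ U : Set (σ → K), IsOpen U → ∃ I : Ideal (MvPolynomial σ K), Uᶜ = zeroLocus K I := by
      intro U hU
      induction hU with
      | basic U hU =>
        obtain ⟨f, rfl⟩ := hU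
        refine ⟨Ideal.span {f}, ?_⟩
        ext x
        rw [mem_zeroLocus_span_singleton]
        simp
      | univ => exact ⟨⊤, by simp⟩
      | inter U V _ _ hU hV =>
        obtain ⟨I, hI⟩ := hU
        obtain ⟨J, hJ⟩ := hV
        exact ⟨I * J, by rw [zeroLocus_mul, Set.compl_inter, hI, hJ]⟩
      | sUnion 𝒰 _ h𝒰 =>
        choose! I hI using h𝒰
        refine ⟨⨆ U ∈ 𝒰, I U, ?_⟩
        ext x
        have := (zeroLocus_vanishingIdeal_galoisConnection (k := K) (K := K) (σ := σ)).l_iSup₂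
          (f := fun U (_ : U ∈ 𝒰) => I U)
        rw [this]
        change _ ↔ x ∈ (⋂ U ∈ 𝒰, zeroLocus K (I U) : Set (σ → K))
        simp only [Set.mem_compl_iff, Set.mem_sUnion, not_exists, not_and, Set.mem_iInter]
        exact forall₂_congr fun U hU => by rw [← hI U hU, Set.mem_compl_iff]
    obtain ⟨I, hI⟩ := this Cᶜ h.isOpen_compl
    exact ⟨I, by rwa [compl_compl] at hI⟩
  · rintro ⟨I, rfl⟩
    have : (zeroLocus K I : Set (σ → K)) = ⋂ f ∈ I, {x | eval x f ≠ 0}ᶜ := by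
      ext x
      simp [aeval_eq_eval]
    rw [this]
    refine isClosed_biInter fun f _ => ?_
    rw [isClosed_compl_iff]
    exact TopologicalSpace.isOpen_generateFrom_of_mem ⟨f, rfl⟩

theorem isClosed_zeroLocus (I : Ideal (MvPolynomial σ K)) :
    @IsClosed _ (zariskiTopology K σ) (zeroLocus K I) :=
  isClosed_zariskiTopology_iff.2 ⟨I, rfl⟩

theorem zeroLocus_subset_of_isClosed [IsAlgClosed K] [Finite σ] {P : Ideal (MvPolynomial σ K)}
    [hP : P.IsPrime] {h : MvPolynomial σ K} (hh : h ∉ P) {C : Set (σ → K)}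
    (hC : @IsClosed _ (zariskiTopology K σ) C) (hPC : ∀ x ∈ zeroLocus K P, eval x h ≠ 0 → x ∈ C) :
    zeroLocus K P ⊆ C := by
  obtain ⟨J, rfl⟩ := isClosed_zariskiTopology_iff.1 hC
  refine zeroLocus_anti_mono fun f hf => ?_
  refine (hP.mem_or_mem (y := h) ?_).resolve_right hh
  rw [← IsPrime.vanishingIdeal_zeroLocus (k := K) (K := K) P]
  intro x hx
  by_cases hxh : eval x h = 0
  · rw [map_mul, aeval_eq_eval, hxh, mul_zero]
  · rw [map_mul, hPC x hx hxh f hf, zero_mul]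

theorem isIrreducible_zeroLocus [IsAlgClosed K] [Finite σ] (P : Ideal (MvPolynomial σ K))
    [hP : P.IsPrime] : @IsIrreducible _ (zariskiTopology K σ) (zeroLocus K P) := by
  let := zariskiTopology K σ
  constructor
  · rw [Set.nonempty_iff_ne_empty]
    intro h
    have := IsPrime.vanishingIdeal_zeroLocus (k := K) (K := K) P
    rw [h, vanishingIdeal_empty] at this
    exact hP.ne_top this.symm
  · rw [isPreirreducible_iff_isClosed_union_isClosed]
    intro C D hC hD hCD
    obtain ⟨I, rfl⟩ := isClosed_zariskiTopology_iff.1 hC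
    by_cases hI : I ≤ P
    · exact Or.inl (zeroLocus_anti_mono hI)
    · obtain ⟨h, hhI, hhP⟩ := SetLike.not_le_iff_exists.1 hI
      exact Or.inr (zeroLocus_subset_of_isClosed hhP hD fun x hx hxh =>
        (hCD hx).resolve_left fun hxI => hxh (hxI h hhI))

end ZariskiTopology

section IsConstructibleIn

variable {α : Type*} {t : TopologicalSpace α}

theorem isConstructibleIn_iUnion_diff {ι : Type*} [Finite ι] {C D : ι → Set α}
    (hC : ∀ i, IsClosed (C i)) (hD : ∀ i, IsClosed (D i)) :
    IsConstructibleIn t (⋃ i, C i \ D i) := by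
  let e := Finite.equivFin ι
  refine ⟨_, C ∘ e.symm, D ∘ e.symm, fun i => hC _, fun i => hD _, ?_⟩
  exact (e.symm.surjective.iUnion_comp fun i => C i \ D i).symm

theorem IsClosed.isConstructibleIn_diff {C D : Set α} (hC : IsClosed C) (hD : IsClosed D) :
    IsConstructibleIn t (C \ D) := by
  have := isConstructibleIn_iUnion_diff (ι := Unit) (fun _ => hC) (fun _ => hD)
  rwa [Set.iUnion_const] at this

theorem isConstructibleIn_empty : IsConstructibleIn t (∅ : Set α) := by
  simpa using isClosed_empty.isConstructibleIn_diff (t := t) isClosed_empty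

theorem IsConstructibleIn.union {S T : Set α} (hS : IsConstructibleIn t S)
    (hT : IsConstructibleIn t T) : IsConstructibleIn t (S ∪ T) := by
  obtain ⟨r, C, D, hC, hD, rfl⟩ := hS
  obtain ⟨r', C', D', hC', hD', rfl⟩ := hT
  have := isConstructibleIn_iUnion_diff (t := t) (C := Sum.elim C C') (D := Sum.elim D D')
    (Sum.rec hC hC') (Sum.rec hD hD')
  rwa [Set.iUnion_sum] at this

/-- A set which is generically full or generically empty on every irreducible closed subset is
constructible. -/
theorem isConstructibleIn_zariskiTopology {K σ : Type*} [Field K] [Finite σ] {E : Set (σ → K)}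
    (hE : ∀ P : Ideal (MvPolynomial σ K), P.IsPrime → ∃ t ∉ P,
      (∀ x ∈ zeroLocus K P, eval x t ≠ 0 → x ∈ E) ∨ ∀ x ∈ zeroLocus K P, eval x t ≠ 0 → x ∉ E) :
    IsConstructibleIn (zariskiTopology K σ) E := by
  suffices h : ∀ I : Ideal (MvPolynomial σ K),
      IsConstructibleIn (zariskiTopology K σ) (E ∩ zeroLocus K I) by
    simpa using h ⊥
  intro I
  induction I using WellFoundedGT.induction with
  | ind I ih =>
    by_cases hI : I = ⊤
    · subst hI
      rw [zeroLocus_top, Set.bot_eq_empty, Set.inter_empty]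
      exact isConstructibleIn_empty
    have hlt : ∀ a ∉ I, I < I ⊔ Ideal.span {a} := fun a ha =>
      left_lt_sup.2 fun h => ha (h (Ideal.mem_span_singleton_self a))
    by_cases hIp : I.IsPrime
    · obtain ⟨t, ht, hP⟩ := hE I hIp
      have hu : E ∩ zeroLocus K I = (E ∩ (zeroLocus K I \ zeroLocus K (Ideal.span {t}))) ∪
          (E ∩ zeroLocus K (I ⊔ Ideal.span {t})) := by
        rw [zeroLocus_sup, ← Set.inter_union_distrib_left, Set.sdiff_union_inter]
      rw [hu]
      refine IsConstructibleIn.union ?_ (ih _ (hlt t ht))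
      rcases hP with hP | hP
      · rw [Set.inter_eq_self_of_subset_right]
        · exact (isClosed_zeroLocus _).isConstructibleIn_diff (isClosed_zeroLocus _)
        · exact fun x hx => hP x hx.1 fun h => hx.2 (mem_zeroLocus_span_singleton.2 h)
      · convert isConstructibleIn_empty
        refine Set.eq_empty_of_forall_notMem fun x hx => hP x hx.2.1 (fun h => ?_) hx.1
        exact hx.2.2 (mem_zeroLocus_span_singleton.2 h)
    · rw [Ideal.isPrime_iff] at hIp
      push Not at hIp
      obtain ⟨a, b, hab, ha, hb⟩ := hIp hI
      have hu : E ∩ zeroLocus K I =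
          (E ∩ zeroLocus K (I ⊔ Ideal.span {a})) ∪ (E ∩ zeroLocus K (I ⊔ Ideal.span {b})) := by
        rw [← Set.inter_union_distrib_left, zeroLocus_sup, zeroLocus_sup,
          ← Set.inter_union_distrib_left, ← zeroLocus_mul, Ideal.span_singleton_mul_span_singleton,
          ← zeroLocus_sup, sup_eq_left.2]
        exact (Ideal.span_singleton_le_iff_mem _).2 hab
      rw [hu]
      exact (ih _ (hlt a ha)).union (ih _ (hlt b hb))

end IsConstructibleIn

/-- A finite family of pairwise incomparable irreducible closed sets is the family of irreducible
components of its union. -/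
theorem irredComps_sUnion {α : Type*} {t : TopologicalSpace α} {𝒯 : Set (Set α)} (hf : 𝒯.Finite)
    (hc : ∀ T ∈ 𝒯, IsClosed T) (hi : ∀ T ∈ 𝒯, IsIrreducible T) (ha : IsAntichain (· ⊆ ·) 𝒯) :
    irredComps t (⋃₀ 𝒯) = 𝒯 := by
  have hex : ∀ Z : Set α, IsIrreducible Z → Z ⊆ ⋃₀ 𝒯 → ∃ T ∈ 𝒯, Z ⊆ T := by
    intro Z hZ hZ𝒯
    have := isIrreducible_iff_sUnion_isClosed.1 hZ hf.toFinset
      (fun T hT => hc T (hf.mem_toFinset.1 hT)) (by rwa [hf.coe_toFinset])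
    simpa using this
  ext T
  constructor
  · intro hT
    obtain ⟨T', hT', hTT'⟩ := hex T hT.1.2.2 hT.1.1
    rwa [Maximal.eq_of_le (P := fun T => T ⊆ ⋃₀ 𝒯 ∧ IsClosed T ∧ IsIrreducible T) hT
      ⟨Set.subset_sUnion_of_mem hT', hc T' hT', hi T' hT'⟩ hTT']
  · refine fun hT => ⟨⟨Set.subset_sUnion_of_mem hT, hc T hT, hi T hT⟩, fun Z hZ hTZ => ?_⟩
    obtain ⟨T', hT', hZT'⟩ := hex Z hZ.2.2 hZ.1
    rwa [ha.eq hT hT' (hTZ.trans hZT')]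

namespace RingSpecialization

variable {L K τ : Type*} [Field L] [Field K]

theorem red_mem_special (s : RingSpecialization L K) {I : Ideal (MvPolynomial τ L)}
    {q : MvPolynomial τ s.R} (hq : s.incl q ∈ I) : s.red q ∈ s.special I :=
  s.mem_special.2 ⟨q, hq, rfl⟩

theorem subtype_eval (s : RingSpecialization L K) (c : τ → s.R) (q : MvPolynomial τ s.R) :
    (eval c q : L) = eval (fun j => (c j : L)) (s.incl q) :=
  (eval₂_comp s.R.subtype c q).trans (eval_map _ _ _).symm

/-- Sufficiently generic specializations preserve (non)membership in a zero locus. -/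
theorem eventually_mem_zeroLocus_special (P : Ideal (MvPolynomial τ L)) (c : τ → L) :
    ∀ᶠ s : RingSpecialization L K in generic L K, ∀ c' : τ → s.R, (∀ j, (c' j : L) = c j) →
      ((fun j => s.φ (c' j)) ∈ zeroLocus K (s.special P) ↔ c ∈ zeroLocus L P) := by
  have key : ∀ s : RingSpecialization L K, ∀ c' : τ → s.R, (∀ j, (c' j : L) = c j) →
      ∀ q : MvPolynomial τ s.R, (eval c' q : L) = eval c (s.incl q) ∧
        eval (fun j => s.φ (c' j)) (s.red q) = s.φ (eval c' q) := by
    intro s c' hc' q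
    rw [s.subtype_eval, funext hc']
    exact ⟨rfl, (eval_map _ _ _).trans (eval₂_comp s.φ c' q).symm⟩
  by_cases hc : c ∈ zeroLocus L P
  · refine Filter.Eventually.of_forall fun s c' hc' => iff_of_true (fun p hp => ?_) hc
    obtain ⟨q, hq, rfl⟩ := s.mem_special.1 hp
    have h0 : eval c' q = 0 := Subtype.ext ((key s c' hc' q).1.trans (hc _ hq))
    exact (key s c' hc' q).2.trans (by rw [h0, map_zero])
  · have hc0 := hc
    rw [mem_zeroLocus_iff_eval] at hc
    push Not at hc
    obtain ⟨g, hg, hgc⟩ := hc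
    filter_upwards [eventually_lift g, eventually_mem (eval c g)⁻¹] with s ⟨q, hq⟩ hs c' hc'
    refine iff_of_false (fun h => ?_) hc0
    have h1 : s.φ (eval c' q) = 0 :=
      (key s c' hc' q).2.symm.trans (h _ (s.red_mem_special (by rwa [hq])))
    have h2 : eval c' q * ⟨_, hs⟩ = 1 := Subtype.ext (by
      rw [Subring.coe_mul, (key s c' hc' q).1, hq]
      exact mul_inv_cancel₀ hgc)
    have h3 := congrArg s.φ h2
    rw [map_mul, h1, zero_mul, map_one] at h3
    exact zero_ne_one h3

/-- The points of the specialization of the constructible set given by equations `G i` and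
inequations `h i`. -/
def specialPoints {ι : Type*} (s : RingSpecialization L K) (G : ι → Set (MvPolynomial τ L))
    (h : ι → MvPolynomial τ L) : Set (τ → K) :=
  {x | ∃ i, (∀ q, s.incl q ∈ G i → eval x (s.red q) = 0) ∧
    ∀ q, s.incl q = h i → eval x (s.red q) ≠ 0}

theorem eventually_not_special_le [IsAlgClosed L] [Finite τ] {P Q : Ideal (MvPolynomial τ L)}
    [hQ : Q.IsPrime] (h : ¬ P ≤ Q) : ∀ᶠ s in generic L K, ¬ s.special P ≤ s.special Q := by
  obtain ⟨f, hfP, hfQ⟩ := SetLike.not_le_iff_exists.1 h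
  have hf : f ∉ Q.radical := by rwa [hQ.radical]
  filter_upwards [eventually_lift f, eventually_red_notMem_special hf] with s ⟨q, hq⟩ hs hle
  exact hs q hq (hle (s.red_mem_special (by rwa [hq])))

/-- Sufficiently generic specializations of a constructible set remain covered by the
specializations of components covering it. -/
theorem eventually_specialPoints_subset [Finite τ] {ι : Type*} [Finite ι]
    (G : ι → Set (MvPolynomial τ L)) (h : ι → MvPolynomial τ L)
    (𝓜 : Finset (Ideal (MvPolynomial τ L)))
    (h𝓜 : ∀ i, ∀ P ∈ (Ideal.span (G i)).minimalPrimes, h i ∉ P → ∃ Q ∈ 𝓜, Q ≤ P) :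
    ∀ᶠ s in generic L K, s.specialPoints G h ⊆ ⋃ P ∈ 𝓜, zeroLocus K (s.special P) := by
  have h1 := Filter.eventually_all.2 fun i => eventually_lift (K := K) (h i)
  have h2 := Filter.eventually_all.2 fun i => eventually_special_span_le (K := K) (G i)
  filter_upwards [h1, h2] with s h1 h2 x ⟨i, hx, hxh⟩
  by_contra hx'
  simp only [Set.mem_iUnion, not_exists, mem_zeroLocus_iff_eval] at hx'
  push Not at hx'
  obtain ⟨qh, hqh⟩ := h1 i
  have hq : ∀ P : 𝓜, ∃ q, s.incl q ∈ P.1 ∧ eval x (s.red q) ≠ 0 := fun P => by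
    obtain ⟨p, hp, hpx⟩ := hx' P.1 P.2
    obtain ⟨q, hq, rfl⟩ := s.mem_special.1 hp
    exact ⟨q, hq, hpx⟩
  choose q hq hqx using hq
  have hrad : s.incl (qh * ∏ P, q P) ∈ (Ideal.span (G i)).radical := by
    rw [← Ideal.sInf_minimalPrimes, Ideal.mem_sInf]
    intro P hP
    rw [map_mul, hqh]
    by_cases hhP : h i ∈ P
    · exact P.mul_mem_right _ hhP
    · obtain ⟨Q, hQ, hQP⟩ := h𝓜 i P hP hhP
      refine P.mul_mem_left _ (hQP ?_)
      rw [map_prod]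
      exact Ideal.mem_of_dvd _ (Finset.dvd_prod_of_mem (fun P => s.incl (q P))
        (Finset.mem_univ (⟨Q, hQ⟩ : 𝓜))) (hq ⟨Q, hQ⟩)
  obtain ⟨N, hN⟩ := hrad
  rw [← map_pow] at hN
  have hmem : x ∈ zeroLocus K (Ideal.span (s.red '' (s.incl ⁻¹' G i))) := by
    rw [zeroLocus_span]
    rintro _ ⟨p, hp, rfl⟩
    exact hx p hp
  have h0 := mem_zeroLocus_iff_eval.1 hmem _ (h2 i (s.red_mem_special hN))
  rw [map_pow, map_pow, map_mul, map_mul, map_prod, map_prod] at h0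
  refine mul_ne_zero (hxh _ hqh) (Finset.prod_ne_zero_iff.2 fun P _ => hqx P)
    (eq_zero_of_pow_eq_zero h0)

/-- Over an algebraically closed field, the irreducible components of the closure of a
constructible set specialize to those of sufficiently generic specializations of it. -/
theorem exists_eventually_irredComps_closure_specialPoints [IsAlgClosed L] [IsAlgClosed K]
    [Finite τ] {ι : Type*} [Finite ι] (G : ι → Set (MvPolynomial τ L)) (h : ι → MvPolynomial τ L) :
    ∃ 𝓜 : Finset (Ideal (MvPolynomial τ L)), ∀ᶠ s in generic L K,
      irredComps (zariskiTopology K τ) (@closure _ (zariskiTopology K τ) (s.specialPoints G h)) =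
        (fun P => zeroLocus K (s.special P)) '' 𝓜 ∧
      Set.InjOn (fun P => zeroLocus K (s.special P)) (𝓜 : Set (Ideal (MvPolynomial τ L))) := by
  classical
  let 𝒬 : Set (Ideal (MvPolynomial τ L)) :=
    ⋃ i, {P ∈ (Ideal.span (G i)).minimalPrimes | h i ∉ P}
  have h𝒬 : 𝒬.Finite := Set.finite_iUnion fun i =>
    (Ideal.finite_minimalPrimes_of_isNoetherianRing _ _).subset (Set.sep_subset _ _)
  have hmin : {P | Minimal (· ∈ 𝒬) P}.Finite := h𝒬.subset fun P hP => hP.prop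
  have hprime : ∀ P ∈ hmin.toFinset, P.IsPrime := by
    intro P hP
    obtain ⟨i, hi⟩ := Set.mem_iUnion.1 ((hmin.mem_toFinset.1 hP).prop)
    exact hi.1.1.1
  have hcov : ∀ i, ∀ P ∈ (Ideal.span (G i)).minimalPrimes, h i ∉ P →
      ∃ Q ∈ hmin.toFinset, Q ≤ P := by
    intro i P hP hhP
    obtain ⟨Q, hQP, hQ⟩ := h𝒬.exists_le_minimal (Set.mem_iUnion.2 ⟨i, hP, hhP⟩)
    exact ⟨Q, hmin.mem_toFinset.2 hQ, hQP⟩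
  have hanti : ∀ P ∈ hmin.toFinset, ∀ Q ∈ hmin.toFinset, P ≠ Q → ¬ P ≤ Q := by
    intro P hP Q hQ hne hle
    exact hne ((hmin.mem_toFinset.1 hQ).eq_of_le (hmin.mem_toFinset.1 hP).prop hle)
  refine ⟨hmin.toFinset, ?_⟩
  have e1 := (Filter.eventually_all_finset _).2 fun P hP =>
    haveI := hprime P hP
    eventually_isPrime_special (K := K) P
  have e2 : ∀ᶠ s in generic L K, ∀ P ∈ hmin.toFinset, ∀ Q ∈ hmin.toFinset, P ≠ Q →
      ¬ s.special P ≤ s.special Q := by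
    refine (Filter.eventually_all_finset _).2 fun P hP =>
      (Filter.eventually_all_finset _).2 fun Q hQ => ?_
    by_cases hne : P = Q
    · exact Filter.Eventually.of_forall fun s hPQ => absurd hne hPQ
    · have := hprime Q hQ
      exact (eventually_not_special_le (hanti P hP Q hQ hne)).mono fun s hs _ => hs
  have e3 : ∀ᶠ s in generic L K, ∀ P ∈ hmin.toFinset, ∀ i, h i ∉ P →
      ∃ q, s.incl q = h i ∧ s.red q ∉ s.special P := by
    refine (Filter.eventually_all_finset _).2 fun P hP => Filter.eventually_all.2 fun i => ?_
    by_cases hhP : h i ∈ P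
    · exact Filter.Eventually.of_forall fun s hPQ => absurd hhP hPQ
    · have hr : h i ∉ P.radical := by rwa [(hprime P hP).radical]
      filter_upwards [eventually_lift (h i), eventually_red_notMem_special hr] with s ⟨q, hq⟩ hs _
      exact ⟨q, hq, hs q hq⟩
  filter_upwards [e1, e2, e3, eventually_specialPoints_subset G h _ hcov] with s e1 e2 e3 e4
  have hle : ∀ P ∈ hmin.toFinset, ∀ Q ∈ hmin.toFinset,
      zeroLocus K (s.special P) ⊆ zeroLocus K (s.special Q) → P = Q := by
    intro P hP Q hQ hPQ
    by_contra hne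
    have := e1 P hP
    have := e1 Q hQ
    refine e2 Q hQ P hP (Ne.symm hne) ?_
    rw [← IsPrime.vanishingIdeal_zeroLocus (k := K) (K := K) (s.special P),
      ← IsPrime.vanishingIdeal_zeroLocus (k := K) (K := K) (s.special Q)]
    exact vanishingIdeal_anti_mono hPQ
  let := zariskiTopology K τ
  have hcl : closure (s.specialPoints G h) =
      ⋃₀ ((fun P => zeroLocus K (s.special P)) '' (hmin.toFinset : Set _)) := by
    rw [Set.sUnion_image]
    refine Set.Subset.antisymm (closure_minimal e4 ?_) (Set.iUnion₂_subset fun P hP => ?_)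
    · exact hmin.toFinset.finite_toSet.isClosed_biUnion fun P _ => isClosed_zeroLocus _
    · have := e1 P hP
      obtain ⟨i, hi⟩ := Set.mem_iUnion.1 ((hmin.mem_toFinset.1 hP).prop)
      obtain ⟨q, hq, hqP⟩ := e3 P hP i hi.2
      refine zeroLocus_subset_of_isClosed hqP isClosed_closure fun x hx hxq => subset_closure ?_
      refine ⟨i, fun p hp => hx _ (s.red_mem_special (hi.1.1.2 (Ideal.subset_span hp))), ?_⟩
      intro q' hq'
      rwa [s.incl_injective (hq'.trans hq.symm)]
  refine ⟨?_, fun P hP Q hQ hPQ => hle P hP Q hQ hPQ.subset⟩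
  rw [hcl]
  refine irredComps_sUnion (hmin.toFinset.finite_toSet.image _) ?_ ?_ ?_
  · rintro _ ⟨P, _, rfl⟩
    exact isClosed_zeroLocus _
  · rintro _ ⟨P, hP, rfl⟩
    have := e1 P hP
    exact isIrreducible_zeroLocus _
  · rintro _ ⟨P, hP, rfl⟩ _ ⟨Q, hQ, rfl⟩ hne hPQ
    exact hne (by rw [hle P hP Q hQ hPQ])

end RingSpecialization

namespace MvPolynomial

variable {α β R B B' : Type*} [CommRing R] [CommRing B] [CommRing B']

/-- Evaluation of the coefficients and of the first block of variables by a ring homomorphism. -/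
noncomputable def partialEval (f : MvPolynomial (α ⊕ β) R →+* B) :
    MvPolynomial (α ⊕ β) R →+* MvPolynomial β B :=
  eval₂Hom (C.comp (f.comp C)) (Sum.elim (fun i => C (f (X (Sum.inl i)))) X)

theorem map_partialEval (f : MvPolynomial (α ⊕ β) R →+* B) (g : B →+* B')
    (p : MvPolynomial (α ⊕ β) R) : map g (partialEval f p) = partialEval (g.comp f) p := by
  suffices h : (map g).comp (partialEval f) = partialEval (g.comp f) from congrArg (fun F => F p) h
  refine ringHom_ext (fun r => ?_) (Sum.rec (fun i => ?_) fun j => ?_) <;> simp [partialEval]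

theorem eval_partialEval_eval (y : α ⊕ β → R) (x : β → R) (p : MvPolynomial (α ⊕ β) R) :
    eval x (partialEval (eval y) p) = eval (Sum.elim (fun i => y (Sum.inl i)) x) p := by
  suffices h : (eval x).comp (partialEval (eval y)) =
      eval (Sum.elim (fun i => y (Sum.inl i)) x) from congrArg (fun F => F p) h
  refine ringHom_ext (fun r => ?_) (Sum.rec (fun i => ?_) fun j => ?_) <;> simp [partialEval]

end MvPolynomial

theorem IsConstructibleIn.exists_eq_setOf {K σ : Type*} [Field K] [Finite σ] {S : Set (σ → K)}
    (hS : IsConstructibleIn (zariskiTopology K σ) S) :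
    ∃ (ι : Type) (_ : Finite ι) (G : ι → Set (MvPolynomial σ K)) (h : ι → MvPolynomial σ K),
      S = {y | ∃ i, (∀ p ∈ G i, eval y p = 0) ∧ eval y (h i) ≠ 0} := by
  obtain ⟨r, C, D, hC, hD, rfl⟩ := hS
  choose a ha using fun i => isClosed_zariskiTopology_iff.1 (hC i)
  choose b hb using fun i => isClosed_zariskiTopology_iff.1 (hD i)
  choose N g hg using fun i => Submodule.fg_iff_exists_fin_generating_family.1
    (IsNoetherian.noetherian (b i))
  refine ⟨Σ i, Fin (N i), inferInstance, fun i => a i.1, fun i => g i.1 i.2, ?_⟩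
  ext y
  have hyD : ∀ i, y ∉ D i ↔ ∃ j, eval y (g i j) ≠ 0 := by
    intro i
    rw [hb, ← hg]
    change y ∉ zeroLocus K (Ideal.span (Set.range (g i))) ↔ _
    rw [zeroLocus_span]
    simp [aeval_eq_eval]
  simp only [Set.mem_iUnion, Set.mem_sdiff, hyD, ha, mem_zeroLocus_iff_eval, Set.mem_ofPred_eq,
    Sigma.exists, SetLike.mem_coe, exists_and_left]

theorem RingSpecialization.specialPoints_partialEval {K L α β ι : Type*} [Field K] [Field L]
    (s : RingSpecialization L K) (G : ι → Set (MvPolynomial (α ⊕ β) K))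
    (h : ι → MvPolynomial (α ⊕ β) K) (f : MvPolynomial (α ⊕ β) K →+* s.R) {y : α ⊕ β → K}
    (hf : s.φ.comp f = eval y) :
    s.specialPoints (fun i => partialEval (s.R.subtype.comp f) '' G i)
      (fun i => partialEval (s.R.subtype.comp f) (h i)) =
      {x | Sum.elim (fun i => y (Sum.inl i)) x ∈
        {z | ∃ i, (∀ p ∈ G i, eval z p = 0) ∧ eval z (h i) ≠ 0}} := by
  have h1 : ∀ p, s.incl (partialEval f p) = partialEval (s.R.subtype.comp f) p :=
    map_partialEval f _
  have h2 : ∀ x p, eval x (s.red (partialEval f p)) =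
      eval (Sum.elim (fun i => y (Sum.inl i)) x) p := by
    intro x p
    rw [RingSpecialization.red, map_partialEval, hf, eval_partialEval_eval]
  ext x
  refine exists_congr fun i => and_congr ⟨fun hx p hp => ?_, ?_⟩ ⟨fun hx => ?_, ?_⟩
  · rw [← h2]
    exact hx _ ⟨p, hp, (h1 p).symm⟩
  · rintro hx q ⟨p, hp, hpq⟩
    rw [← s.incl_injective ((h1 p).trans hpq), h2]
    exact hx p hp
  · rw [← h2]
    exact hx _ (h1 _)
  · rintro hx q hq
    rwa [← s.incl_injective ((h1 _).trans hq.symm), h2]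

theorem faithfulSMul_algebraicClosure_fractionRing (A : Type*) [CommRing A] [IsDomain A] :
    FaithfulSMul A (AlgebraicClosure (FractionRing A)) := by
  rw [faithfulSMul_iff_algebraMap_injective,
    IsScalarTower.algebraMap_eq A (FractionRing A) (AlgebraicClosure (FractionRing A))]
  exact (algebraMap (FractionRing A) _).injective.comp (IsFractionRing.injective A _)

theorem isAlgebraic_algebraicClosure_fractionRing (A : Type*) [CommRing A] [IsDomain A] :
    Algebra.IsAlgebraic A (AlgebraicClosure (FractionRing A)) :=
  (IsFractionRing.comap_isAlgebraic_iff (A := A) (K := FractionRing A)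
    (C := AlgebraicClosure (FractionRing A))).2 inferInstance

/-- The number of irreducible components through a point of the closure of the fibre of a
constructible set is generically constant on every irreducible closed set. -/
theorem exists_generic_ncard_irredComps {K α β ι : Type*} [Field K] [IsAlgClosed K] [Finite β]
    [Finite ι] (G : ι → Set (MvPolynomial (α ⊕ β) K)) (h : ι → MvPolynomial (α ⊕ β) K)
    (P : Ideal (MvPolynomial (α ⊕ β) K)) [P.IsPrime] :
    ∃ t ∉ P, ∃ N : ℕ, ∀ y ∈ zeroLocus K P, eval y t ≠ 0 →
      ∀ 𝒯, 𝒯 = {T | T ∈ irredComps (zariskiTopology K β) (@closure _ (zariskiTopology K β)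
          {x | Sum.elim (fun i => y (Sum.inl i)) x ∈
            {z | ∃ i, (∀ p ∈ G i, eval z p = 0) ∧ eval z (h i) ≠ 0}}) ∧
          (fun j => y (Sum.inr j)) ∈ T} → 𝒯.Finite ∧ 𝒯.ncard = N := by
  classical
  let A := MvPolynomial (α ⊕ β) K ⧸ P
  let L := AlgebraicClosure (FractionRing A)
  have := faithfulSMul_algebraicClosure_fractionRing A
  have := isAlgebraic_algebraicClosure_fractionRing A
  let f : MvPolynomial (α ⊕ β) K →+* L := (algebraMap A L).comp (Ideal.Quotient.mk P)
  let c : β → L := fun j => f (X (Sum.inr j))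
  obtain ⟨𝓜, h𝓜⟩ := RingSpecialization.exists_eventually_irredComps_closure_specialPoints (K := K)
    (fun i => partialEval f '' G i) (fun i => partialEval f (h i))
  have hc := (Filter.eventually_all_finset 𝓜).2 fun P _ =>
    RingSpecialization.eventually_mem_zeroLocus_special (K := K) P c
  obtain ⟨t, ht, htP⟩ := RingSpecialization.exists_of_eventually (A := A) (h𝓜.and hc)
  obtain ⟨t, rfl⟩ := Ideal.Quotient.mk_surjective t
  refine ⟨t, fun h => ht (Ideal.Quotient.eq_zero_iff_mem.2 h),
    (𝓜.filter fun Q => c ∈ zeroLocus L Q).card, ?_⟩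
  rintro y hy hyt _ rfl
  let ψ : A →+* K := Ideal.Quotient.lift P (eval y) hy
  have hψ : ∀ p, ψ (Ideal.Quotient.mk P p) = eval y p := fun p => rfl
  obtain ⟨s, ⟨⟨hcomp, hinj⟩, hsc⟩, hs⟩ := htP ψ
    (fun k => ⟨Ideal.Quotient.mk P (C k), by rw [hψ, eval_C]⟩) hyt
  let g : MvPolynomial (α ⊕ β) K →+* s.R := f.codRestrict s.R fun p => (hs _).1
  have hg : s.φ.comp g = eval y := by
    refine RingHom.ext fun p => ?_
    exact (hs (Ideal.Quotient.mk P p)).2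
  have hgf : s.R.subtype.comp g = f := rfl
  have hpts := s.specialPoints_partialEval G h g hg
  rw [hgf] at hpts
  have hT : {T | T ∈ irredComps (zariskiTopology K β) (@closure _ (zariskiTopology K β)
          {x | Sum.elim (fun i => y (Sum.inl i)) x ∈
            {z | ∃ i, (∀ p ∈ G i, eval z p = 0) ∧ eval z (h i) ≠ 0}}) ∧
          (fun j => y (Sum.inr j)) ∈ T} =
      (fun Q => zeroLocus K (s.special Q)) '' (𝓜.filter fun Q => c ∈ zeroLocus L Q) := by
    have hyc : (fun j => s.φ (g (X (Sum.inr j)))) = fun j => y (Sum.inr j) := by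
      funext j
      exact (congrArg (fun F => F (X (Sum.inr j))) hg).trans (eval_X _)
    have hmem : ∀ Q ∈ 𝓜, ((fun j => y (Sum.inr j)) ∈ zeroLocus K (s.special Q) ↔
        c ∈ zeroLocus L Q) := by
      intro Q hQ
      rw [← hyc]
      exact hsc Q hQ (fun j => g (X (Sum.inr j))) fun j => rfl
    rw [← hpts, hcomp]
    ext T
    simp only [Set.mem_ofPred_eq, Finset.coe_filter]
    constructor
    · rintro ⟨⟨Q, hQ, rfl⟩, hy⟩
      exact ⟨Q, ⟨hQ, (hmem Q hQ).1 hy⟩, rfl⟩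
    · rintro ⟨Q, ⟨hQ, hy⟩, rfl⟩
      exact ⟨⟨Q, hQ, rfl⟩, (hmem Q hQ).2 hy⟩
  rw [hT]
  refine ⟨(Finset.finite_toSet _).image _, ?_⟩
  rw [Set.InjOn.ncard_image (hinj.mono (Finset.coe_subset.2 (Finset.filter_subset _ _))),
    Set.ncard_coe_finset]

/-- The family of irreducible components of the Zariski closure is definable in
families over an algebraically closed field: if `S ⊆ K^m × K^n` is constructible
(the product identified with `K^{m+n}`, coordinates indexed by `Fin m ⊕ Fin n`),
then for each `k` the set of pairs `(a, x)` such that `x` lies in exactly `k`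
irreducible components of the Zariski closure of `S_a` is constructible. -/
theorem components_definable_in_families
    {K : Type*} [Field K] [IsAlgClosed K] (m n : ℕ)
    (S : Set (Fin m ⊕ Fin n → K))
    (hS : IsConstructibleIn (zariskiTopology K (Fin m ⊕ Fin n)) S) :
    ∀ k : ℕ, IsConstructibleIn (zariskiTopology K (Fin m ⊕ Fin n))
      {y : Fin m ⊕ Fin n → K |
        {T | T ∈ irredComps (zariskiTopology K (Fin n))
              (@closure _ (zariskiTopology K (Fin n))
                {x : Fin n → K | Sum.elim (fun i => y (Sum.inl i)) x ∈ S}) ∧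
            (fun i => y (Sum.inr i)) ∈ T}.Finite ∧
        {T | T ∈ irredComps (zariskiTopology K (Fin n))
              (@closure _ (zariskiTopology K (Fin n))
                {x : Fin n → K | Sum.elim (fun i => y (Sum.inl i)) x ∈ S}) ∧
            (fun i => y (Sum.inr i)) ∈ T}.ncard = k} := by
  intro k
  obtain ⟨ι, _, G, h, rfl⟩ := hS.exists_eq_setOf
  refine isConstructibleIn_zariskiTopology fun P hP => ?_
  obtain ⟨t, ht, N, hN⟩ := exists_generic_ncard_irredComps G h P
  refine ⟨t, ht, ?_⟩
  by_cases hk : N = k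
  · subst hk
    exact Or.inl fun y hy hyt => hN y hy hyt _ rfl
  · exact Or.inr fun y hy hyt hyk => hk ((hN y hy hyt _ rfl).2.symm.trans hyk.2)
end
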